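/- arXiv:2401.08628 — 2 statements merged into one kernel-verified Lean document; each statement's English description precedes it below -/
import Mathlib

section
/- Let k > 0, r₀ > 0, x₀ ∈ ℝ², and let d = (cos α, sin α) ∈ ℝ² be a unit vector. Assume Hₘ⁽¹⁾(kr₀) ≠ 0 for every m ∈ ℤ, and define aₘ = −i^m e^{i k d·x₀} e^{−i m α} Jₘ(kr₀)/Hₘ⁽¹⁾(kr₀). Then: (i) for every r ≥ r₀ and θ ∈ ℝ the series u^s(r, θ) = Σₘ∈ℤ aₘ Hₘ⁽¹⁾(kr) e^{imθ} converges absolutely; (ii) the series Σₘ∈ℤ (−i)^m aₘ e^{imθ} converges absolutely; and (iii) for every θ ∈ ℝ, lim_{r→∞} √r · e^{−ikr} · u^s(r, θ) = √(2/(πk)) · e^{−iπ/4} · Σₘ∈ℤ (−i)^m aₘ e^{imθ} = −√(2/(πk)) · e^{−iπ/4} · e^{i k d·x₀} · Σₘ∈ℤ e^{im(θ−α)} Jₘ(kr₀)/Hₘ⁽¹⁾(kr₀). -/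
open Real MeasureTheory

/-- Bessel function of the first kind of integer order `m`, via the integral representation
`J_m(x) = (1/π) ∫₀^π cos (mθ − x sin θ) dθ`. -/
noncomputable def besselJ (m : ℤ) (x : ℝ) : ℝ :=
  (1 / π) * ∫ θ in (0:ℝ)..π, Real.cos (m * θ - x * Real.sin θ)

/-- Bessel function of the second kind of integer order `m`, via the integral representation
`Y_m(x) = (1/π) ∫₀^π sin (x sin θ − mθ) dθ − (1/π) ∫₀^∞ (e^{ms} + (−1)^m e^{−ms}) e^{−x sinh s} ds`. -/
noncomputable def besselY (m : ℤ) (x : ℝ) : ℝ :=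
  (1 / π) * (∫ θ in (0:ℝ)..π, Real.sin (x * Real.sin θ - m * θ))
    - (1 / π) * ∫ s in Set.Ioi (0:ℝ),
        (Real.exp (m * s) + (-1 : ℝ) ^ m * Real.exp (-(m * s))) * Real.exp (-x * Real.sinh s)

/-- Hankel function of the first kind of integer order: `H_m^{(1)} = J_m + i Y_m`. -/
noncomputable def hankelH1 (m : ℤ) (x : ℝ) : ℂ := besselJ m x + Complex.I * besselY m x

/-- Hankel function of the second kind of integer order: `H_m^{(2)} = J_m − i Y_m`. -/
noncomputable def hankelH2 (m : ℤ) (x : ℝ) : ℂ := besselJ m x - Complex.I * besselY m x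

lemma byparts_bound {a b : ℝ} (hab : a ≤ b) (E E' f f' : ℝ → ℂ)
    (hE : ∀ t ∈ Set.Icc a b, HasDerivAt E (E' t) t)
    (hE' : ContinuousOn E' (Set.Icc a b))
    (hf : ∀ t ∈ Set.Icc a b, HasDerivAt f (f' t) t)
    (hf' : ContinuousOn f' (Set.Icc a b))
    (hE1 : ∀ t ∈ Set.Icc a b, ‖E t‖ ≤ 1) :
    ‖∫ t in a..b, f t * E' t‖ ≤ ‖f b‖ + ‖f a‖ + ∫ t in a..b, ‖f' t‖ := by
  have hu : Set.uIcc a b = Set.Icc a b := Set.uIcc_of_le hab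
  rw [← hu] at hE' hf'
  rw [intervalIntegral.integral_mul_deriv_eq_deriv_mul (u := f) (v := E) (u' := f') (v' := E')
    (by rwa [hu]) (by rwa [hu]) hf'.intervalIntegrable hE'.intervalIntegrable]
  have h1 : ‖f b * E b‖ ≤ ‖f b‖ := by
    rw [norm_mul]
    exact mul_le_of_le_one_right (norm_nonneg _) (hE1 b ⟨hab, le_rfl⟩)
  have h2 : ‖f a * E a‖ ≤ ‖f a‖ := by
    rw [norm_mul]
    exact mul_le_of_le_one_right (norm_nonneg _) (hE1 a ⟨le_rfl, hab⟩)
  have h3 : ‖∫ x in a..b, f' x * E x‖ ≤ ∫ t in a..b, ‖f' t‖ := by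
    apply intervalIntegral.norm_integral_le_of_norm_le hab
    · refine Filter.Eventually.of_forall fun t ht => ?_
      rw [norm_mul]
      exact mul_le_of_le_one_right (norm_nonneg _) (hE1 t ⟨ht.1.le, ht.2⟩)
    · exact hf'.norm.intervalIntegrable
  calc _ ≤ ‖f b * E b‖ + ‖f a * E a‖ + ‖∫ x in a..b, f' x * E x‖ :=
        (norm_sub_le _ _).trans (add_le_add (norm_sub_le _ _) le_rfl)
    _ ≤ _ := by linarith

lemma gauss_tail (b : ℂ) (hb : 0 ≤ b.re) (hb1 : 1 ≤ ‖b‖) {A B : ℝ} (hA : 0 < A) (hAB : A ≤ B) :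
    ‖∫ v in A..B, Complex.exp (-b * (v : ℂ) ^ 2)‖ ≤ 1 / A := by
  have hb0 : b ≠ 0 := by
    intro h; rw [h] at hb1; norm_num at hb1
  have hpos : ∀ t ∈ Set.Icc A B, 0 < t := fun t ht => hA.trans_le ht.1
  have key := byparts_bound hAB (fun v : ℝ => Complex.exp (-b * (v : ℂ) ^ 2))
    (fun v : ℝ => Complex.exp (-b * (v : ℂ) ^ 2) * (-b * (2 * (v : ℂ))))
    (fun v : ℝ => (-2 * b)⁻¹ * ((v⁻¹ : ℝ) : ℂ))
    (fun v : ℝ => (-2 * b)⁻¹ * ((-(v ^ 2)⁻¹ : ℝ) : ℂ)) ?_ ?_ ?_ ?_ ?_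
  · have e1 : ∫ v in A..B, Complex.exp (-b * (v : ℂ) ^ 2) =
        ∫ v in A..B, (-2 * b)⁻¹ * ((v⁻¹ : ℝ) : ℂ) *
          (Complex.exp (-b * (v : ℂ) ^ 2) * (-b * (2 * (v : ℂ)))) := by
      apply intervalIntegral.integral_congr
      intro v hv
      rw [Set.uIcc_of_le hAB] at hv
      have : (v : ℂ) ≠ 0 := by exact_mod_cast (hpos v hv).ne'
      push_cast
      field_simp
    rw [e1]
    refine key.trans ?_
    have e2 : ∫ t in A..B, ‖(-2 * b)⁻¹ * ((-(t ^ 2)⁻¹ : ℝ) : ℂ)‖ =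
        (2 * ‖b‖)⁻¹ * (A⁻¹ - B⁻¹) := by
      have : ∀ t : ℝ, ‖(-2 * b)⁻¹ * ((-(t ^ 2)⁻¹ : ℝ) : ℂ)‖ = (2 * ‖b‖)⁻¹ * (t ^ 2)⁻¹ := by
        intro t
        rw [norm_mul, norm_inv, norm_mul, norm_neg, Complex.norm_real, norm_neg]
        simp
      simp_rw [this]
      rw [intervalIntegral.integral_const_mul]
      congr 1
      have := intervalIntegral.integral_eq_sub_of_hasDerivAt (a := A) (b := B)
        (f := fun t : ℝ => -t⁻¹) (f' := fun t => (t ^ 2)⁻¹) ?_ ?_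
      · rw [this]; ring
      · intro t ht
        rw [Set.uIcc_of_le hAB] at ht
        have h := (hasDerivAt_inv (hpos t ht).ne').neg
        rw [neg_neg] at h
        exact h
      · apply ContinuousOn.intervalIntegrable
        rw [Set.uIcc_of_le hAB]
        exact ContinuousOn.inv₀ (by fun_prop) fun t ht => (pow_pos (hpos t ht) 2).ne'
    rw [e2]
    have hB : 0 < B := hA.trans_le hAB
    simp only [norm_mul, norm_inv, norm_neg, Complex.norm_real, Complex.norm_ofNat]
    rw [Real.norm_of_nonneg hA.le, Real.norm_of_nonneg hB.le]
    have : (2 * ‖b‖)⁻¹ ≤ 2⁻¹ := by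
      apply inv_anti₀ (by norm_num); linarith
    have hA' : 0 < A⁻¹ := inv_pos.mpr hA
    rw [one_div]
    nlinarith
  · intro t ht
    have h : HasDerivAt (fun v : ℂ => Complex.exp (-b * v ^ 2))
        (Complex.exp (-b * (t : ℂ) ^ 2) * (-b * (2 * (t : ℂ)))) (t : ℂ) := by
      have := ((hasDerivAt_pow 2 (t : ℂ)).const_mul (-b)).cexp
      simpa using this
    exact h.comp_ofReal
  · fun_prop
  · intro t ht
    exact ((hasDerivAt_inv (hpos t ht).ne').ofReal_comp).const_mul _
  · refine ContinuousOn.mul continuousOn_const (Complex.continuous_ofReal.comp_continuousOn ?_)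
    exact (ContinuousOn.inv₀ (by fun_prop) fun t ht => (pow_pos (hpos t ht) 2).ne').neg
  · intro t ht
    rw [Complex.norm_exp]
    apply Real.exp_le_one_iff.mpr
    have : (-b * (t : ℂ) ^ 2).re = - b.re * t ^ 2 := by
      rw [← Complex.ofReal_pow, Complex.re_mul_ofReal]; simp
    rw [this]
    nlinarith [sq_nonneg t]

lemma sqrt_pi_div_I : ((π : ℂ) / Complex.I) ^ (1 / 2 : ℂ) / 2 =
    (Real.sqrt π : ℂ) / 2 * Complex.exp (-(Complex.I * ((π : ℂ) / 4))) := by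
  have h0 : ((π : ℂ) / Complex.I) ≠ 0 := by simp [Real.pi_ne_zero]
  have h1 : Complex.log ((π : ℂ) / Complex.I) = (Real.log π : ℂ) + -(π / 2) * Complex.I := by
    rw [Complex.div_I, ← mul_neg, Complex.log_ofReal_mul Real.pi_pos (by simp), Complex.log_neg_I]
  rw [Complex.cpow_def_of_ne_zero h0, h1, add_mul, Complex.exp_add]
  have h2 : Complex.exp ((Real.log π : ℂ) * (1 / 2)) = (Real.sqrt π : ℂ) := by
    rw [Real.sqrt_eq_rpow, Real.rpow_def_of_pos Real.pi_pos]
    push_cast; rfl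
  rw [h2]
  have : -((π : ℂ) / 2) * Complex.I * (1 / 2) = -(Complex.I * ((π : ℂ) / 4)) := by ring
  rw [this]; ring

lemma fresnel_bound {A : ℝ} (hA : 0 < A) :
    ‖(∫ v in (0:ℝ)..A, Complex.exp (-Complex.I * (v : ℂ) ^ 2)) -
      (Real.sqrt π : ℂ) / 2 * Complex.exp (-(Complex.I * ((π : ℂ) / 4)))‖ ≤ 1 / A := by
  rw [← sqrt_pi_div_I]
  -- regularised version
  have hre : ∀ ε : ℝ, ((ε : ℂ) + Complex.I).re = ε := by intro ε; simp
  have hnorm : ∀ ε : ℝ, 1 ≤ ‖(ε : ℂ) + Complex.I‖ := by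
    intro ε
    have := Complex.abs_im_le_norm ((ε : ℂ) + Complex.I)
    simpa using this
  have h1 : ∀ ε : ℝ, 0 < ε →
      ‖(∫ v in (0:ℝ)..A, Complex.exp (-((ε : ℂ) + Complex.I) * (v : ℂ) ^ 2)) -
        ((π : ℂ) / ((ε : ℂ) + Complex.I)) ^ (1 / 2 : ℂ) / 2‖ ≤ 1 / A := by
    intro ε hε
    have hb : 0 < ((ε : ℂ) + Complex.I).re := by rw [hre]; exact hε
    have ht := intervalIntegral_tendsto_integral_Ioi (0:ℝ)
      (integrable_cexp_neg_mul_sq hb).integrableOn Filter.tendsto_id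
    rw [integral_gaussian_complex_Ioi hb] at ht
    have ht2 := (tendsto_const_nhds (x := ∫ v in (0:ℝ)..A,
      Complex.exp (-((ε : ℂ) + Complex.I) * (v : ℂ) ^ 2))).sub ht
    refine le_of_tendsto ht2.norm ?_
    filter_upwards [Filter.eventually_ge_atTop A] with B hB
    have hi : ∀ a b : ℝ, IntervalIntegrable
        (fun v : ℝ => Complex.exp (-((ε : ℂ) + Complex.I) * (v : ℂ) ^ 2)) volume a b := by
      intro a b
      apply Continuous.intervalIntegrable
      fun_prop
    rw [norm_sub_rev, id, intervalIntegral.integral_interval_sub_left (hi _ _) (hi _ _)]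
    exact gauss_tail _ hb.le (hnorm ε) hA hB
  have h2 : Filter.Tendsto (fun ε : ℝ =>
      (∫ v in (0:ℝ)..A, Complex.exp (-((ε : ℂ) + Complex.I) * (v : ℂ) ^ 2)) -
        ((π : ℂ) / ((ε : ℂ) + Complex.I)) ^ (1 / 2 : ℂ) / 2) (nhdsWithin 0 (Set.Ioi 0))
      (nhds ((∫ v in (0:ℝ)..A, Complex.exp (-Complex.I * (v : ℂ) ^ 2)) -
        ((π : ℂ) / Complex.I) ^ (1 / 2 : ℂ) / 2)) := by
    apply Filter.Tendsto.mono_left _ nhdsWithin_le_nhds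
    apply Filter.Tendsto.sub
    · have hc : Continuous (fun ε : ℝ =>
          ∫ v in (0:ℝ)..A, Complex.exp (-((ε : ℂ) + Complex.I) * (v : ℂ) ^ 2)) := by
        apply intervalIntegral.continuous_parametric_intervalIntegral_of_continuous'
        fun_prop
      simpa using hc.tendsto 0
    · apply Filter.Tendsto.div_const
      have hd : Filter.Tendsto (fun ε : ℝ => (π : ℂ) / ((ε : ℂ) + Complex.I)) (nhds 0)
          (nhds ((π : ℂ) / Complex.I)) := by
        have : ContinuousAt (fun ε : ℝ => (π : ℂ) / ((ε : ℂ) + Complex.I)) 0 := by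
          apply ContinuousAt.div (by fun_prop) (by fun_prop)
          simp
        simpa using this.tendsto
      apply Filter.Tendsto.cpow hd tendsto_const_nhds
      rw [Complex.mem_slitPlane_iff]
      right
      simp [Real.pi_ne_zero]
  refine le_of_tendsto h2.norm ?_
  filter_upwards [self_mem_nhdsWithin] with ε hε using h1 ε hε

lemma osc_bound {x : ℝ} (hx : 0 < x) (f f' : ℝ → ℝ) (D : ℝ)
    (hf : ∀ t ∈ Set.Icc (0:ℝ) (π / 2), HasDerivAt f (f' t) t)
    (hf' : ContinuousOn f' (Set.Icc (0:ℝ) (π / 2)))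
    (hD : ∀ t ∈ Set.Icc (0:ℝ) (π / 2), |f' t| ≤ D) :
    ‖∫ t in (0:ℝ)..(π / 2), Complex.exp (Complex.I * x * (Real.cos t : ℂ)) *
      ((Real.sin t * f t : ℝ) : ℂ)‖ ≤ (|f (π / 2)| + |f 0| + D * (π / 2)) / x := by
  have hp : (0:ℝ) ≤ π / 2 := by positivity
  have hxc : (x : ℂ) ≠ 0 := by exact_mod_cast hx.ne'
  have key := byparts_bound hp
    (fun t : ℝ => Complex.exp (Complex.I * x * (Real.cos t : ℂ)))
    (fun t : ℝ => Complex.exp (Complex.I * x * (Real.cos t : ℂ)) *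
      (Complex.I * x * ((-Real.sin t : ℝ) : ℂ)))
    (fun t => -(Complex.I * x)⁻¹ * (f t : ℂ)) (fun t => -(Complex.I * x)⁻¹ * (f' t : ℂ))
    ?_ ?_ ?_ ?_ ?_
  · have e1 : ∫ t in (0:ℝ)..(π / 2), Complex.exp (Complex.I * x * (Real.cos t : ℂ)) *
        ((Real.sin t * f t : ℝ) : ℂ) = ∫ t in (0:ℝ)..(π / 2), -(Complex.I * x)⁻¹ * (f t : ℂ) *
        (Complex.exp (Complex.I * x * (Real.cos t : ℂ)) *
          (Complex.I * x * ((-Real.sin t : ℝ) : ℂ))) := by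
      congr 1
      ext t
      push_cast
      field_simp
    rw [e1]
    refine key.trans ?_
    have hn : ∀ y : ℝ, ‖-(Complex.I * (x : ℂ))⁻¹ * (y : ℂ)‖ = x⁻¹ * |y| := by
      intro y
      simp [abs_of_pos hx]
    simp_rw [hn]
    rw [intervalIntegral.integral_const_mul]
    have h3 : ∫ t in (0:ℝ)..(π / 2), |f' t| ≤ D * (π / 2) := by
      have := intervalIntegral.integral_mono_on hp (f := fun t => |f' t|) (g := fun _ => D)
        (μ := volume) ?_ ?_ hD
      · simpa [mul_comm] using this
      · apply ContinuousOn.intervalIntegrable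
        rw [Set.uIcc_of_le hp]
        exact hf'.abs
      · exact intervalIntegrable_const
    have : 0 < x⁻¹ := inv_pos.mpr hx
    have h4 := mul_le_mul_of_nonneg_left h3 this.le
    rw [div_eq_inv_mul _ x]
    linarith
  · intro t _
    exact (((Real.hasDerivAt_cos t).ofReal_comp).const_mul (Complex.I * (x : ℂ))).cexp
  · fun_prop
  · intro t ht
    exact ((hf t ht).ofReal_comp).const_mul _
  · exact ContinuousOn.mul continuousOn_const (Complex.continuous_ofReal.comp_continuousOn hf')
  · intro t _
    have : Complex.I * (x : ℂ) * (Real.cos t : ℂ) = ((x * Real.cos t : ℝ) : ℂ) * Complex.I := by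
      push_cast; ring
    rw [this, Complex.norm_exp_ofReal_mul_I]

/-- auxiliary oscillatory integral -/
noncomputable def oscK (μ x : ℝ) : ℂ :=
  ∫ t in (0:ℝ)..(π / 2), Complex.exp (Complex.I * x * (Real.cos t : ℂ)) *
    ((Real.cos (μ * t) : ℝ) : ℂ)

lemma oscK_sub (μ ν x : ℝ) : oscK μ x - oscK ν x =
    ∫ t in (0:ℝ)..(π / 2), Complex.exp (Complex.I * x * (Real.cos t : ℂ)) *
      ((Real.cos (μ * t) - Real.cos (ν * t) : ℝ) : ℂ) := by
  unfold oscK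
  rw [← intervalIntegral.integral_sub]
  · congr 1
    ext t
    push_cast
    ring
  · apply Continuous.intervalIntegrable
    fun_prop
  · apply Continuous.intervalIntegrable
    fun_prop

lemma cos_half_lower {t : ℝ} (ht : t ∈ Set.Icc (0:ℝ) (π / 2)) : 1 / 2 < Real.cos (t / 2) := by
  have h := Real.cos_le_cos_of_nonneg_of_le_pi (x := t / 2) (y := π / 4)
    (by linarith [ht.1]) (by linarith [Real.pi_pos]) (by linarith [ht.2])
  rw [Real.cos_pi_div_four] at h
  have : (1:ℝ) < Real.sqrt 2 := by
    rw [Real.lt_sqrt] <;> norm_num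
  linarith

lemma oscK_step {x : ℝ} (hx : 0 < x) (n : ℕ) :
    ‖oscK ((n + 1 : ℕ) : ℝ) x - oscK (n : ℝ) x‖ ≤ 20 * (n + 1) / x := by
  rw [oscK_sub]
  set c : ℝ := (n : ℝ) + 1 / 2 with hc
  have hcn : 0 < c := by positivity
  have e1 : ∫ t in (0:ℝ)..(π / 2), Complex.exp (Complex.I * x * (Real.cos t : ℂ)) *
      ((Real.cos (((n + 1 : ℕ) : ℝ) * t) - Real.cos ((n : ℝ) * t) : ℝ) : ℂ) =
      ∫ t in (0:ℝ)..(π / 2), Complex.exp (Complex.I * x * (Real.cos t : ℂ)) *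
      ((Real.sin t * (-Real.sin (c * t) / Real.cos (t / 2)) : ℝ) : ℂ) := by
    apply intervalIntegral.integral_congr
    intro t ht
    rw [Set.uIcc_of_le (by positivity)] at ht
    have hc2 := cos_half_lower ht
    simp only
    congr 2
    rw [Real.cos_sub_cos]
    have h1 : (((n + 1 : ℕ) : ℝ) * t + n * t) / 2 = c * t := by push_cast; rw [hc]; ring
    have h2 : (((n + 1 : ℕ) : ℝ) * t - n * t) / 2 = t / 2 := by push_cast; ring
    have h3 : Real.sin t = 2 * Real.sin (t / 2) * Real.cos (t / 2) := by
      rw [← Real.sin_two_mul]; congr 1; ring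
    rw [h1, h2, h3]
    field_simp
  rw [e1]
  refine (osc_bound hx _ (fun t => (-(Real.cos (c * t) * c) * Real.cos (t / 2) -
      -Real.sin (c * t) * (-Real.sin (t / 2) * (1 / 2))) / Real.cos (t / 2) ^ 2)
      (4 * (c + 1 / 2)) ?_ ?_ ?_).trans ?_
  · intro t ht
    have hc2 := cos_half_lower ht
    have d1 : HasDerivAt (fun t => -Real.sin (c * t)) (-(Real.cos (c * t) * c)) t := by
      have := ((hasDerivAt_id t).const_mul c).sin.neg
      rw [mul_one] at this
      exact this
    have d2 : HasDerivAt (fun t => Real.cos (t / 2)) (-Real.sin (t / 2) * (1 / 2)) t :=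
      ((hasDerivAt_id t).div_const 2).cos
    exact d1.div d2 (by linarith)
  · apply ContinuousOn.div (by fun_prop) (by fun_prop)
    intro t ht
    have hc2 := cos_half_lower ht
    positivity
  · intro t ht
    have hc2 := cos_half_lower ht
    rw [abs_div, abs_of_pos (a := Real.cos (t / 2) ^ 2) (by positivity), div_le_iff₀ (by positivity)]
    have hq : 1 ≤ 4 * Real.cos (t / 2) ^ 2 := by nlinarith
    have b1 : |-(Real.cos (c * t) * c) * Real.cos (t / 2)| ≤ c := by
      rw [abs_mul, abs_neg, abs_mul, abs_of_pos hcn]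
      have u1 := Real.abs_cos_le_one (c * t)
      have u2 := Real.abs_cos_le_one (t / 2)
      calc _ ≤ (1 * c) * 1 := by gcongr
        _ = c := by ring
    have b2 : |-Real.sin (c * t) * (-Real.sin (t / 2) * (1 / 2))| ≤ 1 / 2 := by
      rw [abs_mul, abs_neg, abs_mul, abs_neg]
      have u1 := Real.abs_sin_le_one (c * t)
      have u2 := Real.abs_sin_le_one (t / 2)
      calc _ ≤ 1 * (1 * |(1/2 : ℝ)|) := by gcongr
        _ = 1 / 2 := by norm_num
    have b3 := abs_sub (-(Real.cos (c * t) * c) * Real.cos (t / 2))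
      (-Real.sin (c * t) * (-Real.sin (t / 2) * (1 / 2)))
    nlinarith
  · have hc2 := cos_half_lower (t := π / 2) ⟨by positivity, le_rfl⟩
    have b1 : |-Real.sin (c * (π / 2)) / Real.cos (π / 2 / 2)| ≤ 2 := by
      rw [abs_div, abs_neg, abs_of_pos (a := Real.cos _) (by linarith), div_le_iff₀ (by linarith)]
      linarith [Real.abs_sin_le_one (c * (π / 2))]
    have b2 : |-Real.sin (c * 0) / Real.cos (0 / 2)| = 0 := by simp
    rw [b2]
    gcongr
    have : π ≤ 4 := Real.pi_le_four
    have hn : (0:ℝ) ≤ n := by positivity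
    rw [hc] at b1 ⊢
    nlinarith

lemma oscK_diff {x : ℝ} (hx : 0 < x) (n : ℕ) :
    ‖oscK (n : ℝ) x - oscK 0 x‖ ≤ 20 * n ^ 2 / x := by
  induction n with
  | zero => simp
  | succ n ih =>
    have h := oscK_step hx n
    calc _ = ‖(oscK ((n + 1 : ℕ) : ℝ) x - oscK (n : ℝ) x) + (oscK (n : ℝ) x - oscK 0 x)‖ := by
          congr 1; ring
      _ ≤ _ := norm_add_le _ _
      _ ≤ 20 * (n + 1) / x + 20 * n ^ 2 / x := add_le_add h ih
      _ = (20 * (n + 1) + 20 * n ^ 2) / x := by ring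
      _ ≤ _ := by
        gcongr
        push_cast
        have hn : (0:ℝ) ≤ n := by positivity
        nlinarith

lemma oscK_zero_half : ∃ C : ℝ, 0 ≤ C ∧ ∀ x : ℝ, 0 < x →
    ‖oscK 0 x - oscK (1 / 2) x‖ ≤ C / x := by
  set f : ℝ → ℝ := fun t => Real.sin (t / 4) / (2 * Real.cos (t / 4) * Real.cos (t / 2)) with hfdef
  set f' : ℝ → ℝ := deriv f with hf'def
  have hc4 : ∀ t ∈ Set.Icc (0:ℝ) (π / 2), 0 < Real.cos (t / 4) := by
    intro t ht
    apply Real.cos_pos_of_mem_Ioo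
    constructor <;> linarith [ht.1, ht.2, Real.pi_pos]
  have hcd : ∀ t ∈ Set.Icc (0:ℝ) (π / 2), ContDiffAt ℝ 2 f t := by
    intro t ht
    have h2 := cos_half_lower ht
    have h4 := hc4 t ht
    apply ContDiffAt.div
    · fun_prop
    · fun_prop
    · positivity
  have hder : ∀ t ∈ Set.Icc (0:ℝ) (π / 2), HasDerivAt f (f' t) t := fun t ht =>
    ((hcd t ht).differentiableAt (by norm_num)).hasDerivAt
  have hcont : ContinuousOn f' (Set.Icc (0:ℝ) (π / 2)) := by
    intro t ht
    have h1 : ContDiffAt ℝ 1 (fderiv ℝ f) t := (hcd t ht).fderiv_right (by norm_num)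
    have h2 : ContinuousAt (fun s => fderiv ℝ f s 1) t :=
      h1.continuousAt.clm_apply continuousAt_const
    exact h2.continuousWithinAt
  obtain ⟨D, hD⟩ := isCompact_Icc.exists_bound_of_continuousOn hcont
  refine ⟨|f (π / 2)| + |f 0| + |D| * (π / 2), by positivity, fun x hx => ?_⟩
  have h := osc_bound hx f f' |D| hder hcont (fun t ht => (hD t ht).trans (le_abs_self D))
  refine le_trans (le_of_eq ?_) h
  rw [oscK_sub]
  congr 1
  apply intervalIntegral.integral_congr
  intro t ht
  rw [Set.uIcc_of_le (by positivity)] at ht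
  have h2 := cos_half_lower ht
  have h4 := hc4 t ht
  simp only
  congr 2
  rw [zero_mul, Real.cos_zero, hfdef]
  have s1 : Real.sin t = 2 * (2 * Real.sin (t / 4) * Real.cos (t / 4)) * Real.cos (t / 2) := by
    rw [← Real.sin_two_mul, show 2 * (t / 4) = t / 2 by ring, ← Real.sin_two_mul]; congr 1; ring
  have s2 : Real.cos (1 / 2 * t) = 1 - 2 * Real.sin (t / 4) ^ 2 := by
    rw [show 1 / 2 * t = 2 * (t / 4) by ring, Real.cos_two_mul']
    linear_combination Real.cos_sq_add_sin_sq (t / 4)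
  have : Real.cos (t / 2) ≠ 0 := by positivity
  rw [s1, s2]
  simp only
  field_simp
  ring

lemma oscK_half {x : ℝ} (hx : 0 < x) :
    (Real.sqrt (x / 2) : ℂ) * Complex.exp (-(Complex.I * x)) * oscK (1 / 2) x =
      ∫ v in (0:ℝ)..(Real.sqrt x), Complex.exp (-Complex.I * (v : ℂ) ^ 2) := by
  have hs := intervalIntegral.integral_deriv_smul_comp (a := 0) (b := π / 2)
    (f := fun t => Real.sqrt (2 * x) * Real.sin (t / 2))
    (f' := fun t => Real.sqrt (2 * x) * (Real.cos (t / 2) * (1 / 2)))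
    (g := fun v : ℝ => Complex.exp (-Complex.I * (v : ℂ) ^ 2)) ?_ ?_ ?_
  · have e0 : Real.sqrt (2 * x) * Real.sin (0 / 2) = 0 := by simp
    have hq : Real.sqrt (2 * x) = Real.sqrt 2 * Real.sqrt x := Real.sqrt_mul (by norm_num) _
    have e1 : Real.sqrt (2 * x) * Real.sin (π / 2 / 2) = Real.sqrt x := by
      rw [show π / 2 / 2 = π / 4 by ring, Real.sin_pi_div_four, hq]
      have := Real.mul_self_sqrt (show (0:ℝ) ≤ 2 by norm_num)
      linear_combination (Real.sqrt x / 2) * this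
    rw [e0, e1] at hs
    rw [← hs]
    unfold oscK
    rw [← intervalIntegral.integral_const_mul]
    congr 1
    ext t
    simp only [Function.comp, Complex.real_smul]
    have e2 : Real.sqrt (2 * x) * (Real.cos (t / 2) * (1 / 2)) =
        Real.sqrt (x / 2) * Real.cos (1 / 2 * t) := by
      have : Real.sqrt (2 * x) = 2 * Real.sqrt (x / 2) := by
        rw [show 2 * x = 2 ^ 2 * (x / 2) by ring, Real.sqrt_mul (by norm_num),
          Real.sqrt_sq (by norm_num)]
      rw [this, show 1 / 2 * t = t / 2 by ring]; ring
    rw [e2]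
    have e3 : -Complex.I * ((Real.sqrt (2 * x) * Real.sin (t / 2) : ℝ) : ℂ) ^ 2 =
        -(Complex.I * x) + Complex.I * x * (Real.cos t : ℂ) := by
      have : (Real.sqrt (2 * x) * Real.sin (t / 2)) ^ 2 = x * (1 - Real.cos t) := by
        rw [mul_pow, Real.sq_sqrt (by positivity)]
        have : Real.cos t = 1 - 2 * Real.sin (t / 2) ^ 2 := by
          conv_lhs => rw [show t = 2 * (t / 2) by ring, Real.cos_two_mul']
          linear_combination Real.cos_sq_add_sin_sq (t / 2)
        rw [this]; ring
      rw [← Complex.ofReal_pow, this]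
      push_cast; ring
    rw [e3, Complex.exp_add]
    push_cast
    ring
  · intro t _
    exact (((hasDerivAt_id t).div_const 2).sin).const_mul _
  · fun_prop
  · fun_prop

/-- auxiliary monotone integral -/
noncomputable def besP (x μ : ℝ) : ℝ :=
  ∫ s in Set.Ioi (0:ℝ), Real.exp (μ * s) * Real.exp (-x * Real.sinh s)

lemma sinh_lower {s : ℝ} (hs : 0 ≤ s) : s ^ 2 / 4 ≤ Real.sinh s := by
  rw [Real.sinh_eq]
  have h1 := Real.quadratic_le_exp_of_nonneg hs
  have h2 : Real.exp (-s) ≤ 1 := Real.exp_le_one_iff.mpr (by linarith)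
  linarith

lemma besP_integrable {x : ℝ} (hx : 0 < x) (μ : ℝ) :
    IntegrableOn (fun s : ℝ => Real.exp (μ * s) * Real.exp (-x * Real.sinh s)) (Set.Ioi 0) := by
  have h0 : IntegrableOn (fun s : ℝ => Real.exp ((μ + 1) ^ 2 / x) * Real.exp (-s)) (Set.Ioi 0) :=
    (integrableOn_exp_neg_Ioi 0).const_mul _
  refine Integrable.mono' h0 (by fun_prop) ?_
  filter_upwards [ae_restrict_mem measurableSet_Ioi] with s hs
  have hs : (0:ℝ) < s := hs
  rw [Real.norm_of_nonneg (by positivity), ← Real.exp_add, ← Real.exp_add]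
  apply Real.exp_le_exp.mpr
  have h1 := sinh_lower hs.le
  have h2 : x * (s ^ 2 / 4) ≤ x * Real.sinh s := by gcongr
  have h3 : (μ + 1) * s ≤ (μ + 1) ^ 2 / x + x * (s ^ 2 / 4) := by
    have : (μ + 1) ^ 2 / x + x * (s ^ 2 / 4) - (μ + 1) * s = ((μ + 1) - x * s / 2) ^ 2 / x := by
      field_simp
      ring
    have : 0 ≤ ((μ + 1) - x * s / 2) ^ 2 / x := by positivity
    linarith
  linarith

lemma besP_nonneg (x μ : ℝ) : 0 ≤ besP x μ :=
  integral_nonneg fun s => by positivity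

lemma besP_mono {x : ℝ} (hx : 0 < x) {μ ν : ℝ} (h : μ ≤ ν) : besP x μ ≤ besP x ν := by
  apply setIntegral_mono_on (besP_integrable hx _) (besP_integrable hx _) measurableSet_Ioi
  intro s hs
  have hs : (0:ℝ) < s := hs
  gcongr

lemma besP_anti {x y : ℝ} (hx : 0 < x) (hxy : x ≤ y) (μ : ℝ) : besP y μ ≤ besP x μ := by
  apply setIntegral_mono_on (besP_integrable (hx.trans_le hxy) _) (besP_integrable hx _)
    measurableSet_Ioi
  intro s hs
  have hs : (0:ℝ) < s := hs
  have := Real.sinh_pos_iff.mpr hs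
  gcongr

lemma besP_lower {x : ℝ} (hx : 0 < x) {μ : ℝ} (hμ : 0 ≤ μ) :
    Real.exp μ * Real.exp (-x * Real.sinh 2) ≤ besP x μ := by
  have h1 : ∫ s in Set.Ioc (1:ℝ) 2, Real.exp μ * Real.exp (-x * Real.sinh 2) ≤
      ∫ s in Set.Ioc (1:ℝ) 2, Real.exp (μ * s) * Real.exp (-x * Real.sinh s) := by
    apply setIntegral_mono_on (integrableOn_const (by simp)) _ measurableSet_Ioc
    · intro s hs
      have h2 : Real.sinh s ≤ Real.sinh 2 := Real.sinh_le_sinh.mpr hs.2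
      have h3 : μ ≤ μ * s := le_mul_of_one_le_right hμ hs.1.le
      have h4 : -x * Real.sinh 2 ≤ -x * Real.sinh s := by nlinarith
      gcongr
    · exact (besP_integrable hx μ).mono_set fun s hs => lt_trans one_pos hs.1
  have h2 : ∫ s in Set.Ioc (1:ℝ) 2, Real.exp (μ * s) * Real.exp (-x * Real.sinh s) ≤ besP x μ := by
    apply setIntegral_mono_set (besP_integrable hx μ)
    · exact Filter.Eventually.of_forall fun s => by positivity
    · exact Filter.Eventually.of_forall fun s hs => lt_trans one_pos hs.1
  refine le_trans (le_of_eq ?_) (h1.trans h2)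
  rw [setIntegral_const]
  norm_num

lemma besP_decay {x₀ x : ℝ} (hx₀ : 0 < x₀) (hx : 2 * x₀ ≤ x) {μ : ℝ} (hμ : 0 ≤ μ) :
    besP x μ ≤ (Real.exp (x₀ * Real.sinh 2) + 2) * besP x₀ μ / x := by
  have hxp : 0 < x := by linarith
  have hd : 0 < x - x₀ := by linarith
  have i1 : IntegrableOn (fun s : ℝ => Real.exp μ * Real.exp (-x * s)) (Set.Ioi 0) :=
    (integrableOn_exp_mul_Ioi (by linarith) 0).const_mul _
  have i2 : IntegrableOn (fun s : ℝ => (2 / x) * (Real.exp (μ * s) *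
      Real.exp (-x₀ * Real.sinh s))) (Set.Ioi 0) := (besP_integrable hx₀ μ).const_mul _
  have h1 : besP x μ ≤ ∫ s in Set.Ioi (0:ℝ), (Real.exp μ * Real.exp (-x * s) +
      (2 / x) * (Real.exp (μ * s) * Real.exp (-x₀ * Real.sinh s))) := by
    apply setIntegral_mono_on (besP_integrable hxp _) (i1.add i2) measurableSet_Ioi
    intro s hs
    have hs : (0:ℝ) < s := hs
    have hsh : s ≤ Real.sinh s := Real.self_le_sinh_iff.mpr hs.le
    by_cases hs1 : s ≤ 1
    · have a1 : μ * s ≤ μ := mul_le_of_le_one_right hμ hs1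
      have a2 : -x * Real.sinh s ≤ -x * s := by nlinarith
      have : Real.exp (μ * s) * Real.exp (-x * Real.sinh s) ≤ Real.exp μ * Real.exp (-x * s) := by
        gcongr
      have : 0 ≤ (2 / x) * (Real.exp (μ * s) * Real.exp (-x₀ * Real.sinh s)) := by positivity
      simp only [Pi.add_apply]
      linarith
    · push Not at hs1
      have a1 : Real.exp (-x * Real.sinh s) =
          Real.exp (-x₀ * Real.sinh s) * Real.exp (-((x - x₀) * Real.sinh s)) := by
        rw [← Real.exp_add]; congr 1; ring
      have a2 : Real.exp (-((x - x₀) * Real.sinh s)) ≤ 2 / x := by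
        have b1 : x / 2 ≤ (x - x₀) * Real.sinh s := by nlinarith
        calc Real.exp (-((x - x₀) * Real.sinh s)) ≤ Real.exp (-(x / 2)) := by gcongr
          _ = (Real.exp (x / 2))⁻¹ := Real.exp_neg _
          _ ≤ (x / 2)⁻¹ := by
            apply inv_anti₀ (by positivity)
            linarith [Real.add_one_le_exp (x / 2)]
          _ = 2 / x := by rw [inv_div]
      have : Real.exp (μ * s) * Real.exp (-x * Real.sinh s) ≤
          (2 / x) * (Real.exp (μ * s) * Real.exp (-x₀ * Real.sinh s)) := by
        rw [a1]
        calc _ = Real.exp (-((x - x₀) * Real.sinh s)) *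
              (Real.exp (μ * s) * Real.exp (-x₀ * Real.sinh s)) := by ring
          _ ≤ _ := by gcongr
      have : 0 ≤ Real.exp μ * Real.exp (-x * s) := by positivity
      simp only [Pi.add_apply]
      linarith
  rw [integral_add i1 i2, integral_const_mul, integral_const_mul,
    integral_exp_mul_Ioi (by linarith)] at h1
  have h2 := besP_lower hx₀ hμ
  have h3 : Real.exp μ ≤ Real.exp (x₀ * Real.sinh 2) * besP x₀ μ := by
    calc Real.exp μ = Real.exp (x₀ * Real.sinh 2) *
          (Real.exp μ * Real.exp (-x₀ * Real.sinh 2)) := by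
          rw [← Real.exp_add, ← Real.exp_add]; congr 1; ring
      _ ≤ _ := by gcongr
  have e1 : Real.exp μ * (-Real.exp (-x * 0) / -x) = Real.exp μ / x := by
    simp; ring
  rw [e1] at h1
  calc _ ≤ _ := h1
    _ = (Real.exp μ + 2 * besP x₀ μ) / x := by unfold besP; ring
    _ ≤ _ := by gcongr; linarith

/-- the exponentially damped part of `Y_m` -/
noncomputable def besS (m : ℤ) (x : ℝ) : ℝ := ∫ s in Set.Ioi (0:ℝ),
        (Real.exp (m * s) + (-1 : ℝ) ^ m * Real.exp (-(m * s))) * Real.exp (-x * Real.sinh s)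

lemma besS_eq {x : ℝ} (hx : 0 < x) (m : ℤ) :
    besS m x = besP x m + (-1 : ℝ) ^ m * besP x (-m) := by
  unfold besS besP
  rw [← integral_const_mul, ← integral_add (besP_integrable hx _)
    ((besP_integrable hx _).const_mul _)]
  congr 1
  ext s
  rw [neg_mul]; ring

lemma besS_upper {x : ℝ} (hx : 0 < x) (m : ℤ) : |besS m x| ≤ 2 * besP x |(m : ℝ)| := by
  rw [besS_eq hx]
  refine (abs_add_le _ _).trans ?_
  rw [abs_mul, abs_zpow, abs_neg, abs_one, one_zpow, one_mul, abs_of_nonneg (besP_nonneg _ _),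
    abs_of_nonneg (besP_nonneg _ _)]
  linarith [besP_mono hx (le_abs_self (m : ℝ)), besP_mono hx (neg_le_abs (m : ℝ))]

lemma besS_lower {x : ℝ} (hx : 0 < x) (m : ℤ) :
    besP x |(m : ℝ)| - besP x 0 ≤ |besS m x| := by
  rw [besS_eq hx]
  have hP := besP_nonneg x
  have h1 : |((-1 : ℝ) ^ m * besP x (-m))| = besP x (-m) := by
    rw [abs_mul, abs_zpow, abs_neg, abs_one, one_zpow, one_mul, abs_of_nonneg (hP _)]
  rcases le_total 0 (m : ℝ) with h | h
  · rw [abs_of_nonneg h]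
    have := abs_sub_abs_le_abs_sub (besP x m) (-((-1 : ℝ) ^ m * besP x (-m)))
    rw [sub_neg_eq_add, abs_neg, h1, abs_of_nonneg (hP _)] at this
    linarith [besP_mono hx (show -(m : ℝ) ≤ 0 by linarith)]
  · rw [abs_of_nonpos h]
    have := abs_sub_abs_le_abs_sub ((-1 : ℝ) ^ m * besP x (-m)) (-besP x m)
    rw [sub_neg_eq_add, abs_neg, h1, abs_of_nonneg (hP _), add_comm] at this
    linarith [besP_mono hx h]

lemma neg_I_zpow (m : ℤ) : (-Complex.I) ^ m = Complex.exp (-(Complex.I * m * (π / 2))) := by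
  have : -Complex.I = Complex.exp (-(Complex.I * (π / 2))) := by
    rw [show -(Complex.I * ((π : ℂ) / 2)) = -π / 2 * Complex.I by ring]
    exact Complex.exp_neg_pi_div_two_mul_I.symm
  rw [this, ← Complex.exp_int_mul]
  congr 1; ring

lemma oscI_eq (m : ℤ) (x : ℝ) :
    ∫ θ in (0:ℝ)..π, Complex.exp (Complex.I * ((x * Real.sin θ - m * θ : ℝ) : ℂ)) =
      (-Complex.I) ^ m * 2 * oscK m x := by
  set g : ℝ → ℂ := fun θ => Complex.exp (Complex.I * ((x * Real.sin θ - m * θ : ℝ) : ℂ)) with hg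
  have hgc : Continuous g := by fun_prop
  have h1 : ∫ θ in (0:ℝ)..π, g θ = (∫ θ in (0:ℝ)..(π / 2), g θ) + ∫ θ in (π / 2)..π, g θ :=
    (intervalIntegral.integral_add_adjacent_intervals (hgc.intervalIntegrable _ _)
      (hgc.intervalIntegrable _ _)).symm
  have h2 : ∫ θ in (0:ℝ)..(π / 2), g θ = ∫ t in (0:ℝ)..(π / 2), g (π / 2 - t) := by
    rw [intervalIntegral.integral_comp_sub_left]; simp
  have h3 : ∫ θ in (π / 2)..π, g θ = ∫ t in (0:ℝ)..(π / 2), g (t + π / 2) := by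
    rw [intervalIntegral.integral_comp_add_right]; simp
  rw [h1, h2, h3, ← intervalIntegral.integral_add
    (by apply Continuous.intervalIntegrable; fun_prop)
    (by apply Continuous.intervalIntegrable; fun_prop)]
  unfold oscK
  rw [← intervalIntegral.integral_const_mul]
  congr 1
  ext t
  simp only [hg]
  rw [Real.sin_pi_div_two_sub, Real.sin_add_pi_div_two, neg_I_zpow]
  have c1 : Complex.exp (Complex.I * ((x * Real.cos t - m * (π / 2 - t) : ℝ) : ℂ)) =
      Complex.exp (-(Complex.I * m * (π / 2))) * Complex.exp (Complex.I * x * (Real.cos t : ℂ)) *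
      Complex.exp (((m * t : ℝ) : ℂ) * Complex.I) := by
    rw [← Complex.exp_add, ← Complex.exp_add]; congr 1; push_cast; ring
  have c2 : Complex.exp (Complex.I * ((x * Real.cos t - m * (t + π / 2) : ℝ) : ℂ)) =
      Complex.exp (-(Complex.I * m * (π / 2))) * Complex.exp (Complex.I * x * (Real.cos t : ℂ)) *
      Complex.exp (-((m * t : ℝ) : ℂ) * Complex.I) := by
    rw [← Complex.exp_add, ← Complex.exp_add]; congr 1; push_cast; ring
  have c3 := Complex.two_cos ((m * t : ℝ) : ℂ)
  rw [c1, c2, Complex.ofReal_cos (m * t)]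
  linear_combination (-(Complex.exp (-(Complex.I * m * (π / 2))) *
    Complex.exp (Complex.I * x * (Real.cos t : ℂ)))) * c3

lemma hankel_eq (m : ℤ) (x : ℝ) :
    hankelH1 m x = (1 / π : ℂ) * ((-Complex.I) ^ m * 2 * oscK m x - Complex.I * besS m x) := by
  rw [← oscI_eq]
  have h1 : ∫ θ in (0:ℝ)..π, Complex.exp (Complex.I * ((x * Real.sin θ - m * θ : ℝ) : ℂ)) =
      ((∫ θ in (0:ℝ)..π, Real.cos (m * θ - x * Real.sin θ) : ℝ) : ℂ) +
      Complex.I * ((∫ θ in (0:ℝ)..π, Real.sin (x * Real.sin θ - m * θ) : ℝ) : ℂ) := by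
    rw [← intervalIntegral.integral_ofReal, ← intervalIntegral.integral_ofReal,
      ← intervalIntegral.integral_const_mul, ← intervalIntegral.integral_add]
    · congr 1
      ext θ
      rw [← Real.cos_neg, neg_sub, mul_comm Complex.I, Complex.exp_mul_I, Complex.ofReal_cos,
        Complex.ofReal_sin]
      ring
    · apply Continuous.intervalIntegrable; fun_prop
    · apply Continuous.intervalIntegrable; fun_prop
  rw [h1]
  unfold hankelH1 besselJ besselY besS
  push_cast
  ring

lemma besselJ_rec (m : ℤ) (x : ℝ) :
    (m : ℝ) * besselJ m x = x / 2 * (besselJ (m + 1) x + besselJ (m - 1) x) := by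
  have h0 : ∫ θ in (0:ℝ)..π, Real.cos (m * θ - x * Real.sin θ) * (m - x * Real.cos θ) = 0 := by
    rw [intervalIntegral.integral_eq_sub_of_hasDerivAt
      (f := fun θ => Real.sin (m * θ - x * Real.sin θ))]
    · simp [Real.sin_int_mul_pi]
    · intro t _
      have h1 : HasDerivAt (fun θ : ℝ => (m : ℝ) * θ - x * Real.sin θ) (m - x * Real.cos t) t := by
        have := ((hasDerivAt_id t).const_mul (m : ℝ)).sub ((Real.hasDerivAt_sin t).const_mul x)
        rw [mul_one] at this
        exact this
      exact h1.sin
    · apply Continuous.intervalIntegrable; fun_prop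
  have h1 : ∫ θ in (0:ℝ)..π, Real.cos (m * θ - x * Real.sin θ) * (m - x * Real.cos θ) =
      m * (∫ θ in (0:ℝ)..π, Real.cos (m * θ - x * Real.sin θ)) -
      x / 2 * ((∫ θ in (0:ℝ)..π, Real.cos ((m + 1 : ℤ) * θ - x * Real.sin θ)) +
        ∫ θ in (0:ℝ)..π, Real.cos ((m - 1 : ℤ) * θ - x * Real.sin θ)) := by
    rw [← intervalIntegral.integral_add (by apply Continuous.intervalIntegrable; fun_prop)
      (by apply Continuous.intervalIntegrable; fun_prop), ← intervalIntegral.integral_const_mul,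
      ← intervalIntegral.integral_const_mul, ← intervalIntegral.integral_sub
      (by apply Continuous.intervalIntegrable; fun_prop)
      (by apply Continuous.intervalIntegrable; fun_prop)]
    congr 1
    ext θ
    have a1 : ((m + 1 : ℤ) : ℝ) * θ - x * Real.sin θ = (m * θ - x * Real.sin θ) + θ := by
      push_cast; ring
    have a2 : ((m - 1 : ℤ) : ℝ) * θ - x * Real.sin θ = (m * θ - x * Real.sin θ) - θ := by
      push_cast; ring
    rw [a1, a2, Real.cos_add _ θ, Real.cos_sub _ θ]
    ring
  rw [h0] at h1
  unfold besselJ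
  linear_combination (-(1 / π)) * h1

lemma besselJ_le_one (m : ℤ) (x : ℝ) : |besselJ m x| ≤ 1 := by
  unfold besselJ
  have h := intervalIntegral.norm_integral_le_of_norm_le_const (a := 0) (b := π) (C := 1)
    (f := fun θ => Real.cos (m * θ - x * Real.sin θ))
    (fun θ _ => Real.abs_cos_le_one _)
  rw [sub_zero, abs_of_pos Real.pi_pos, one_mul, Real.norm_eq_abs] at h
  rw [abs_mul, abs_of_pos (by positivity), one_div, inv_mul_le_iff₀ Real.pi_pos, mul_one]
  exact h

lemma besselJ_decay {x : ℝ} (hx : 0 < x) (p : ℕ) : ∃ C : ℝ, 0 ≤ C ∧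
    ∀ m : ℤ, |besselJ m x| * (1 + |(m : ℝ)|) ^ p ≤ C := by
  induction p with
  | zero => exact ⟨1, by norm_num, fun m => by simpa using besselJ_le_one m x⟩
  | succ p ih =>
    obtain ⟨C, hC, h⟩ := ih
    refine ⟨C + x * 2 ^ p * C, by positivity, fun m => ?_⟩
    have aux : ∀ n : ℤ, 1 + |(m : ℝ)| ≤ 2 * (1 + |(n : ℝ)|) →
        |besselJ n x| * (1 + |(m : ℝ)|) ^ p ≤ 2 ^ p * C := by
      intro n hn
      calc |besselJ n x| * (1 + |(m : ℝ)|) ^ p ≤ |besselJ n x| * (2 * (1 + |(n : ℝ)|)) ^ p := by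
            gcongr
        _ = 2 ^ p * (|besselJ n x| * (1 + |(n : ℝ)|) ^ p) := by rw [mul_pow]; ring
        _ ≤ _ := by gcongr; exact h n
    have h1 := aux (m + 1) (by
      push_cast
      have := abs_sub_abs_le_abs_sub (m : ℝ) (-1)
      rw [sub_neg_eq_add, abs_neg, abs_one] at this
      have := abs_nonneg ((m : ℝ) + 1)
      linarith)
    have h2 := aux (m - 1) (by
      push_cast
      have := abs_sub_abs_le_abs_sub (m : ℝ) 1
      rw [abs_one] at this
      have := abs_nonneg ((m : ℝ) - 1)
      linarith)
    have h3 : |(m : ℝ)| * |besselJ m x| ≤ x / 2 * (|besselJ (m + 1) x| + |besselJ (m - 1) x|) := by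
      rw [← abs_mul, besselJ_rec, abs_mul, abs_of_pos (by positivity : 0 < x / 2)]
      gcongr
      exact abs_add_le _ _
    have hq : 0 ≤ (1 + |(m : ℝ)|) ^ p := by positivity
    calc |besselJ m x| * (1 + |(m : ℝ)|) ^ (p + 1)
        = |besselJ m x| * (1 + |(m : ℝ)|) ^ p +
          (|(m : ℝ)| * |besselJ m x|) * (1 + |(m : ℝ)|) ^ p := by rw [pow_succ]; ring
      _ ≤ C + (x / 2 * (|besselJ (m + 1) x| + |besselJ (m - 1) x|)) * (1 + |(m : ℝ)|) ^ p :=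
          add_le_add (h m) (mul_le_mul_of_nonneg_right h3 hq)
      _ = C + x / 2 * (|besselJ (m + 1) x| * (1 + |(m : ℝ)|) ^ p +
            |besselJ (m - 1) x| * (1 + |(m : ℝ)|) ^ p) := by ring
      _ ≤ C + x / 2 * (2 ^ p * C + 2 ^ p * C) := by gcongr
      _ = _ := by ring

lemma summable_inv_sq_int : Summable fun m : ℤ => ((1 + |(m : ℝ)|) ^ 2)⁻¹ := by
  have h : Summable fun m : ℤ => ((m : ℝ) ^ 2)⁻¹ := by
    have := Real.summable_one_div_int_pow.mpr (show 1 < 2 by norm_num)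
    simpa using this
  apply Summable.of_norm_bounded_eventually h
  filter_upwards [(Set.finite_singleton (0:ℤ)).compl_mem_cofinite] with m hm
  have hm : m ≠ 0 := hm
  have : 0 < |(m : ℝ)| := abs_pos.mpr (by exact_mod_cast hm)
  rw [Real.norm_of_nonneg (by positivity), ← sq_abs (m : ℝ)]
  gcongr
  linarith

lemma besselJ_summable {x : ℝ} (hx : 0 < x) :
    Summable fun m : ℤ => |besselJ m x| * (1 + (m : ℝ) ^ 2) := by
  obtain ⟨C, hC, h⟩ := besselJ_decay hx 4
  refine Summable.of_nonneg_of_le (fun m => by positivity) (fun m => ?_)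
    (summable_inv_sq_int.mul_left C)
  have h1 : 1 + (m : ℝ) ^ 2 ≤ (1 + |(m : ℝ)|) ^ 2 := by
    rw [← sq_abs (m : ℝ)]; nlinarith [abs_nonneg (m : ℝ)]
  have hp : 0 < (1 + |(m : ℝ)|) ^ 2 := by positivity
  rw [← div_eq_mul_inv, le_div_iff₀ hp]
  calc _ ≤ |besselJ m x| * (1 + |(m : ℝ)|) ^ 2 * (1 + |(m : ℝ)|) ^ 2 := by gcongr
    _ = |besselJ m x| * (1 + |(m : ℝ)|) ^ 4 := by ring
    _ ≤ C := h m

lemma oscK_abs (m : ℤ) (x : ℝ) : oscK (m : ℝ) x = oscK ((m.natAbs : ℕ) : ℝ) x := by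
  unfold oscK
  congr 1
  ext t
  congr 2
  have : ((m.natAbs : ℕ) : ℝ) = |(m : ℝ)| := by
    rw [Nat.cast_natAbs]; push_cast; rfl
  rw [this]
  rcases abs_choice (m : ℝ) with h | h <;> rw [h]
  rw [neg_mul, Real.cos_neg]

lemma oscK_estimate : ∃ C : ℝ, 0 ≤ C ∧ ∀ x : ℝ, 0 < x → ∀ m : ℤ,
    ‖(Real.sqrt x : ℂ) * Complex.exp (-(Complex.I * x)) * (2 * oscK m x) -
      (Real.sqrt 2 * Real.sqrt π : ℝ) * Complex.exp (-(Complex.I * ((π : ℂ) / 4)))‖ ≤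
      C * (1 + (m : ℝ) ^ 2) / Real.sqrt x := by
  obtain ⟨C, hC, h0⟩ := oscK_zero_half
  refine ⟨2 * C + 44, by positivity, fun x hx m => ?_⟩
  have hsx : 0 < Real.sqrt x := Real.sqrt_pos.mpr hx
  have h1 : ‖oscK m x - oscK 0 x‖ ≤ 20 * (m : ℝ) ^ 2 / x := by
    rw [oscK_abs]
    refine (oscK_diff hx _).trans (le_of_eq ?_)
    rw [Nat.cast_natAbs]; push_cast; rw [sq_abs]
  have h2 := h0 x hx
  have h3 := fresnel_bound hsx
  have h4 := oscK_half hx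
  have hs : Real.sqrt x = Real.sqrt 2 * Real.sqrt (x / 2) := by
    rw [← Real.sqrt_mul (by norm_num)]; congr 1; ring
  rw [← h4] at h3
  set E := Complex.exp (-(Complex.I * (x : ℂ))) with hE
  have hEn : ‖E‖ = 1 := by
    rw [hE, show -(Complex.I * (x : ℂ)) = ((-x : ℝ) : ℂ) * Complex.I by push_cast; ring,
      Complex.norm_exp_ofReal_mul_I]
  set e4 := Complex.exp (-(Complex.I * ((π : ℂ) / 4)))
  have e : (Real.sqrt x : ℂ) * E * (2 * oscK m x) - (Real.sqrt 2 * Real.sqrt π : ℝ) * e4 =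
      (2 * Real.sqrt x : ℝ) * E * ((oscK m x - oscK 0 x) + (oscK 0 x - oscK (1 / 2) x)) +
      (2 * Real.sqrt 2 : ℝ) * ((Real.sqrt (x / 2) : ℂ) * E * oscK (1 / 2) x -
        (Real.sqrt π : ℂ) / 2 * e4) := by
    rw [hs]; push_cast; ring
  rw [e]
  have hs2 : Real.sqrt 2 ≤ 2 := by rw [Real.sqrt_le_left] <;> norm_num
  calc _ ≤ ‖((2 * Real.sqrt x : ℝ) : ℂ) * E * ((oscK m x - oscK 0 x) +
        (oscK 0 x - oscK (1 / 2) x))‖ + ‖((2 * Real.sqrt 2 : ℝ) : ℂ) *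
        ((Real.sqrt (x / 2) : ℂ) * E * oscK (1 / 2) x - (Real.sqrt π : ℂ) / 2 * e4)‖ :=
        norm_add_le _ _
    _ ≤ (2 * Real.sqrt x) * (20 * (m : ℝ) ^ 2 / x + C / x) + (2 * 2) * (1 / Real.sqrt x) := by
        rw [norm_mul, norm_mul, norm_mul, hEn, mul_one, Complex.norm_real, Complex.norm_real,
          Real.norm_of_nonneg (by positivity), Real.norm_of_nonneg (by positivity)]
        gcongr
        exact (norm_add_le _ _).trans (add_le_add h1 h2)
    _ = (40 * (m : ℝ) ^ 2 + 2 * C + 4) / Real.sqrt x := by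
        have : x = Real.sqrt x ^ 2 := (Real.sq_sqrt hx.le).symm
        rw [← add_div]
        nth_rewrite 2 [this]
        field_simp
        ring
    _ ≤ _ := by
        gcongr
        nlinarith [sq_nonneg (m : ℝ), mul_nonneg hC (sq_nonneg (m : ℝ))]

lemma hankel_estimate {x₀ : ℝ} (hx₀ : 0 < x₀) : ∃ C : ℝ, 0 ≤ C ∧ ∀ x : ℝ, 2 * x₀ ≤ x → ∀ m : ℤ,
    ‖(Real.sqrt x : ℂ) * Complex.exp (-(Complex.I * x)) * hankelH1 m x -
      (Real.sqrt (2 / π) : ℂ) * Complex.exp (-(Complex.I * ((π : ℂ) / 4))) * (-Complex.I) ^ m‖ ≤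
      C * (1 + (m : ℝ) ^ 2 + besP x₀ |(m : ℝ)|) / Real.sqrt x := by
  obtain ⟨C, hC, h⟩ := oscK_estimate
  set D := Real.exp (x₀ * Real.sinh 2) + 2 with hD
  have hDp : 0 < D := by positivity
  refine ⟨C + 2 * D, by positivity, fun x hx m => ?_⟩
  have hxp : 0 < x := by linarith
  have hsx : 0 < Real.sqrt x := Real.sqrt_pos.mpr hxp
  have h1 := h x hxp m
  have h2 := (besS_upper hxp m).trans
    (mul_le_mul_of_nonneg_left (besP_decay hx₀ hx (abs_nonneg (m : ℝ))) (by norm_num))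
  rw [← hD] at h2
  set E := Complex.exp (-(Complex.I * (x : ℂ))) with hE
  have hEn : ‖E‖ = 1 := by
    rw [hE, show -(Complex.I * (x : ℂ)) = ((-x : ℝ) : ℂ) * Complex.I by push_cast; ring,
      Complex.norm_exp_ofReal_mul_I]
  set e4 := Complex.exp (-(Complex.I * ((π : ℂ) / 4)))
  have hIm : ‖(-Complex.I) ^ m‖ = 1 := by rw [norm_zpow, norm_neg, Complex.norm_I, one_zpow]
  have hpi : (π : ℂ) ≠ 0 := by exact_mod_cast Real.pi_ne_zero
  have hsq : Real.sqrt (2 / π) = 1 / π * (Real.sqrt 2 * Real.sqrt π) := by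
    rw [Real.sqrt_div (by norm_num)]
    have := Real.mul_self_sqrt Real.pi_pos.le
    have : Real.sqrt π ≠ 0 := by positivity
    field_simp
    nlinarith
  have e : (Real.sqrt x : ℂ) * E * hankelH1 m x - (Real.sqrt (2 / π) : ℂ) * e4 * (-Complex.I) ^ m =
      (1 / π : ℝ) * ((-Complex.I) ^ m * ((Real.sqrt x : ℂ) * E * (2 * oscK m x) -
        (Real.sqrt 2 * Real.sqrt π : ℝ) * e4) - Complex.I * E * (Real.sqrt x * besS m x : ℝ)) := by
    rw [hankel_eq, hsq]; push_cast; ring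
  rw [e, norm_mul, Complex.norm_real, Real.norm_of_nonneg (by positivity)]
  have h5 : ‖(-Complex.I) ^ m * ((Real.sqrt x : ℂ) * E * (2 * oscK m x) -
        (Real.sqrt 2 * Real.sqrt π : ℝ) * e4) - Complex.I * E * (Real.sqrt x * besS m x : ℝ)‖ ≤
      C * (1 + (m : ℝ) ^ 2) / Real.sqrt x + 2 * D * besP x₀ |(m : ℝ)| / Real.sqrt x := by
    refine (norm_sub_le _ _).trans (add_le_add ?_ ?_)
    · rw [norm_mul, hIm, one_mul]; exact h1
    · rw [norm_mul, norm_mul, hEn, Complex.norm_I, one_mul, one_mul, Complex.norm_real,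
        norm_mul, Real.norm_of_nonneg hsx.le, Real.norm_eq_abs]
      calc Real.sqrt x * |besS m x| ≤ Real.sqrt x * (2 * (D * besP x₀ |(m : ℝ)| / x)) := by gcongr
        _ = _ := by
          have : x = Real.sqrt x ^ 2 := (Real.sq_sqrt hxp.le).symm
          nth_rewrite 2 [this]
          field_simp
  have hpi1 : 1 / π ≤ 1 := by
    rw [div_le_one Real.pi_pos]; linarith [Real.pi_gt_three]
  have hP := besP_nonneg x₀ |(m : ℝ)|
  calc _ ≤ 1 * (C * (1 + (m : ℝ) ^ 2) / Real.sqrt x +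
        2 * D * besP x₀ |(m : ℝ)| / Real.sqrt x) := by gcongr
    _ = (C * (1 + (m : ℝ) ^ 2) + 2 * D * besP x₀ |(m : ℝ)|) / Real.sqrt x := by ring
    _ ≤ _ := by
      gcongr
      nlinarith [mul_nonneg hC hP, mul_nonneg hDp.le (sq_nonneg (m : ℝ))]

lemma hankel_upper {x₀ x : ℝ} (hx₀ : 0 < x₀) (hx : x₀ ≤ x) (m : ℤ) :
    ‖hankelH1 m x‖ ≤ 1 + besP x₀ |(m : ℝ)| := by
  have hxp : 0 < x := by linarith
  rw [hankel_eq, ← oscI_eq, norm_mul]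
  have h1 : ‖∫ θ in (0:ℝ)..π, Complex.exp (Complex.I * ((x * Real.sin θ - m * θ : ℝ) : ℂ))‖ ≤ π := by
    have h := intervalIntegral.norm_integral_le_of_norm_le_const (a := 0) (b := π) (C := 1)
      (f := fun θ => Complex.exp (Complex.I * ((x * Real.sin θ - m * θ : ℝ) : ℂ)))
      (fun θ _ => by rw [mul_comm, Complex.norm_exp_ofReal_mul_I])
    rwa [sub_zero, abs_of_pos Real.pi_pos, one_mul] at h
  have h2 := (besS_upper hxp m).trans
    (mul_le_mul_of_nonneg_left (besP_anti hx₀ hx |(m : ℝ)|) (by norm_num))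
  have h3 : ‖(1 / π : ℂ)‖ = 1 / π := by simp [abs_of_pos Real.pi_pos]
  rw [h3, one_div, inv_mul_le_iff₀ Real.pi_pos]
  refine (norm_sub_le _ _).trans ?_
  rw [norm_mul, Complex.norm_I, one_mul, Complex.norm_real, Real.norm_eq_abs]
  nlinarith [besP_nonneg x₀ |(m : ℝ)|, Real.pi_gt_three]

lemma hankel_lower {x₀ : ℝ} (hx₀ : 0 < x₀) : ∀ᶠ m : ℤ in Filter.cofinite,
    1 ≤ ‖hankelH1 m x₀‖ ∧ besP x₀ |(m : ℝ)| ≤ 2 * π * ‖hankelH1 m x₀‖ := by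
  have ht : Filter.Tendsto (fun m : ℤ => besP x₀ |(m : ℝ)|) Filter.cofinite Filter.atTop := by
    have h1 : Filter.Tendsto (fun m : ℤ => |(m : ℝ)|) Filter.cofinite Filter.atTop := by
      rw [Int.cofinite_eq]
      exact Filter.Tendsto.sup
        (Filter.tendsto_abs_atBot_atTop.comp (tendsto_intCast_atBot_iff.mpr Filter.tendsto_id))
        (Filter.tendsto_abs_atTop_atTop.comp tendsto_intCast_atTop_atTop)
    have h2 := (Real.tendsto_exp_atTop.comp h1).atTop_mul_const
      (Real.exp_pos (-x₀ * Real.sinh 2))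
    exact Filter.tendsto_atTop_mono (fun m => besP_lower hx₀ (abs_nonneg _)) h2
  filter_upwards [ht.eventually_ge_atTop (2 * (besP x₀ 0 + π))] with m hm
  have h1 := besS_lower hx₀ m
  have h0 := besP_nonneg x₀ 0
  have h3 : π * ‖hankelH1 m x₀‖ = ‖(∫ θ in (0:ℝ)..π,
      Complex.exp (Complex.I * ((x₀ * Real.sin θ - m * θ : ℝ) : ℂ))) -
      Complex.I * besS m x₀‖ := by
    have h3 : ‖(1 / π : ℂ)‖ = 1 / π := by simp [abs_of_pos Real.pi_pos]
    rw [hankel_eq, oscI_eq, norm_mul, h3]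
    field_simp
  have h4 : ‖∫ θ in (0:ℝ)..π, Complex.exp (Complex.I * ((x₀ * Real.sin θ - m * θ : ℝ) : ℂ))‖ ≤ π := by
    have h := intervalIntegral.norm_integral_le_of_norm_le_const (a := 0) (b := π) (C := 1)
      (f := fun θ => Complex.exp (Complex.I * ((x₀ * Real.sin θ - m * θ : ℝ) : ℂ)))
      (fun θ _ => by rw [mul_comm, Complex.norm_exp_ofReal_mul_I])
    rwa [sub_zero, abs_of_pos Real.pi_pos, one_mul] at h
  have h5 := norm_sub_norm_le (Complex.I * (besS m x₀ : ℂ)) (∫ θ in (0:ℝ)..π,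
      Complex.exp (Complex.I * ((x₀ * Real.sin θ - m * θ : ℝ) : ℂ)))
  rw [norm_sub_rev, ← h3, norm_mul, Complex.norm_I, one_mul, Complex.norm_real,
    Real.norm_eq_abs] at h5
  have hpi := Real.pi_gt_three
  have h6 : besP x₀ |(m : ℝ)| ≤ 2 * π * ‖hankelH1 m x₀‖ := by linarith
  refine ⟨?_, h6⟩
  by_contra hlt
  push Not at hlt
  nlinarith

lemma coeff_summable {x₀ : ℝ} (hx₀ : 0 < x₀) :
    Summable fun m : ℤ => |besselJ m x₀| / ‖hankelH1 m x₀‖ *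
      (1 + (m : ℝ) ^ 2 + besP x₀ |(m : ℝ)|) := by
  apply Summable.of_norm_bounded_eventually ((besselJ_summable hx₀).mul_left (1 + 2 * π))
  filter_upwards [hankel_lower hx₀] with m hm
  have hP := besP_nonneg x₀ |(m : ℝ)|
  rw [Real.norm_of_nonneg (by positivity)]
  have hpos : 0 < ‖hankelH1 m x₀‖ := by linarith [hm.1]
  rw [div_mul_eq_mul_div, div_le_iff₀ hpos]
  calc |besselJ m x₀| * (1 + (m : ℝ) ^ 2 + besP x₀ |(m : ℝ)|)
      ≤ |besselJ m x₀| * ((1 + 2 * π) * (1 + (m : ℝ) ^ 2) * ‖hankelH1 m x₀‖) := by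
        gcongr
        have h1 : (1 + (m : ℝ) ^ 2) * 1 ≤ (1 + (m : ℝ) ^ 2) * ‖hankelH1 m x₀‖ := by
          gcongr; exact hm.1
        have h2 : 0 ≤ 2 * π * (m : ℝ) ^ 2 * ‖hankelH1 m x₀‖ := by positivity
        nlinarith [hm.2]
    _ = _ := by ring

/-- Theorem A.2: the far-field pattern of the scattered field for a sound-soft disk
`B(x₀, r₀)`.  With `aₘ = −i^m e^{i k d·x₀} e^{−imα} J_m(kr₀)/H_m^{(1)}(kr₀)`:
(i) the series `u^s(r,θ) = Σₘ aₘ H_m^{(1)}(kr) e^{imθ}` converges absolutely for `r ≥ r₀`;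
(ii) `Σₘ (−i)^m aₘ e^{imθ}` converges absolutely; and (iii) for every `θ`,
`√r e^{−ikr} u^s(r,θ) → √(2/(πk)) e^{−iπ/4} Σₘ (−i)^m aₘ e^{imθ}
 = −√(2/(πk)) e^{−iπ/4} e^{i k d·x₀} Σₘ e^{im(θ−α)} J_m(kr₀)/H_m^{(1)}(kr₀)` as `r → ∞`. -/
theorem disk_far_field_pattern
    (k r₀ : ℝ) (hk : 0 < k) (hr₀ : 0 < r₀) (x₀ : ℝ × ℝ) (α : ℝ)
    (hH1 : ∀ m : ℤ, hankelH1 m (k * r₀) ≠ 0)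
    (a : ℤ → ℂ)
    (ha : ∀ m : ℤ, a m = - Complex.I ^ m *
        Complex.exp (Complex.I * (k : ℂ) * ((Real.cos α * x₀.1 + Real.sin α * x₀.2 : ℝ) : ℂ)) *
        Complex.exp (-(Complex.I * (m : ℂ) * (α : ℂ))) *
        (besselJ m (k * r₀) : ℂ) / hankelH1 m (k * r₀)) :
    (∀ r : ℝ, r₀ ≤ r → ∀ θ : ℝ, Summable (fun m : ℤ =>
        ‖a m * hankelH1 m (k * r) * Complex.exp (Complex.I * (m : ℂ) * (θ : ℂ))‖)) ∧
    (∀ θ : ℝ, Summable (fun m : ℤ =>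
        ‖(-Complex.I) ^ m * a m * Complex.exp (Complex.I * (m : ℂ) * (θ : ℂ))‖)) ∧
    (∀ θ : ℝ,
      Filter.Tendsto
        (fun r : ℝ => (Real.sqrt r : ℂ) * Complex.exp (-(Complex.I * (k : ℂ) * (r : ℂ))) *
          ∑' m : ℤ, a m * hankelH1 m (k * r) * Complex.exp (Complex.I * (m : ℂ) * (θ : ℂ)))
        Filter.atTop
        (nhds ((Real.sqrt (2 / (π * k)) : ℂ) * Complex.exp (-(Complex.I * ((π : ℂ) / 4))) *
          ∑' m : ℤ, (-Complex.I) ^ m * a m * Complex.exp (Complex.I * (m : ℂ) * (θ : ℂ)))) ∧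
      (Real.sqrt (2 / (π * k)) : ℂ) * Complex.exp (-(Complex.I * ((π : ℂ) / 4))) *
          (∑' m : ℤ, (-Complex.I) ^ m * a m * Complex.exp (Complex.I * (m : ℂ) * (θ : ℂ)))
        = -((Real.sqrt (2 / (π * k)) : ℂ) * Complex.exp (-(Complex.I * ((π : ℂ) / 4))) *
            Complex.exp (Complex.I * (k : ℂ) * ((Real.cos α * x₀.1 + Real.sin α * x₀.2 : ℝ) : ℂ)) *
            ∑' m : ℤ, Complex.exp (Complex.I * (m : ℂ) * ((θ - α : ℝ) : ℂ)) *
              (besselJ m (k * r₀) : ℂ) / hankelH1 m (k * r₀))) := by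
  set x : ℝ := k * r₀ with hxdef
  have hx : 0 < x := mul_pos hk hr₀
  have hexp : ∀ y : ℝ, ‖Complex.exp (Complex.I * (y : ℂ))‖ = 1 := fun y => by
    rw [mul_comm, Complex.norm_exp_ofReal_mul_I]
  have hexp2 : ∀ (m : ℤ) (θ : ℝ), ‖Complex.exp (Complex.I * (m : ℂ) * (θ : ℂ))‖ = 1 := by
    intro m θ
    have := hexp (m * θ)
    rw [← this]; congr 2; push_cast; ring
  have hIm : ∀ m : ℤ, ‖(-Complex.I) ^ m‖ = 1 := fun m => by
    rw [norm_zpow, norm_neg, Complex.norm_I, one_zpow]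
  have han : ∀ m : ℤ, ‖a m‖ = |besselJ m x| / ‖hankelH1 m x‖ := by
    intro m
    have h1 : ‖Complex.exp (Complex.I * (k : ℂ) *
        ((Real.cos α * x₀.1 + Real.sin α * x₀.2 : ℝ) : ℂ))‖ = 1 := by
      have := hexp (k * (Real.cos α * x₀.1 + Real.sin α * x₀.2))
      rw [← this]; congr 2; push_cast; ring
    have h2 : ‖Complex.exp (-(Complex.I * (m : ℂ) * (α : ℂ)))‖ = 1 := by
      rw [Complex.exp_neg, norm_inv, hexp2, inv_one]
    rw [ha m, norm_div, norm_mul, norm_mul, norm_mul, norm_neg, norm_zpow, Complex.norm_I,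
      one_zpow, h1, h2, Complex.norm_real, Real.norm_eq_abs]
    simp
  have hsum := coeff_summable hx
  have hPn : ∀ m : ℤ, 0 ≤ besP x |(m : ℝ)| := fun m => besP_nonneg _ _
  have hii : ∀ θ : ℝ, Summable (fun m : ℤ =>
      ‖(-Complex.I) ^ m * a m * Complex.exp (Complex.I * (m : ℂ) * (θ : ℂ))‖) := by
    intro θ
    refine Summable.of_nonneg_of_le (fun m => norm_nonneg _) (fun m => ?_) hsum
    rw [norm_mul, norm_mul, hexp2, hIm, one_mul, mul_one, han]
    exact le_mul_of_one_le_right (by positivity) (by nlinarith [hPn m, sq_nonneg (m : ℝ)])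
  refine ⟨?_, hii, fun θ => ⟨?_, ?_⟩⟩
  · intro r hr θ
    refine Summable.of_nonneg_of_le (fun m => norm_nonneg _) (fun m => ?_) hsum
    rw [norm_mul, norm_mul, hexp2, mul_one, han]
    have h := hankel_upper hx (x := k * r) (mul_le_mul_of_nonneg_left hr hk.le) m
    gcongr
    nlinarith [sq_nonneg (m : ℝ)]
  · obtain ⟨C, hC, hest⟩ := hankel_estimate hx
    set e4 := Complex.exp (-(Complex.I * ((π : ℂ) / 4))) with he4
    have he4n : ‖e4‖ = 1 := by
      have := hexp (π / 4)
      rw [he4, Complex.exp_neg, norm_inv]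
      push_cast at this
      rw [this, inv_one]
    have hsk : 0 < Real.sqrt k := Real.sqrt_pos.mpr hk
    have hskc : (Real.sqrt k : ℂ) ≠ 0 := by exact_mod_cast hsk.ne'
    have hc : Real.sqrt (2 / (π * k)) = Real.sqrt (2 / π) / Real.sqrt k := by
      rw [← div_div, Real.sqrt_div (by positivity)]
    -- the rescaled terms
    have hterm : ∀ r : ℝ, 0 ≤ r → ∀ m : ℤ,
        (Real.sqrt r : ℂ) * Complex.exp (-(Complex.I * (k : ℂ) * (r : ℂ))) * hankelH1 m (k * r) =
        (Real.sqrt k : ℂ)⁻¹ * ((Real.sqrt (k * r) : ℂ) *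
          Complex.exp (-(Complex.I * ((k * r : ℝ) : ℂ))) * hankelH1 m (k * r)) := by
      intro r hr m
      rw [Real.sqrt_mul hk.le]
      push_cast
      rw [← mul_assoc Complex.I]
      field_simp
    set B : ℝ := Real.sqrt (2 / π) + C / Real.sqrt (2 * x) with hB
    have hs2x : 0 < Real.sqrt (2 * x) := Real.sqrt_pos.mpr (by linarith)
    have hBn : 0 ≤ B := by positivity
    have hlarge : ∀ᶠ r : ℝ in Filter.atTop, 2 * x ≤ k * r ∧ 0 ≤ r := by
      filter_upwards [Filter.eventually_ge_atTop (2 * r₀)] with r hr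
      constructor
      · rw [hxdef]; nlinarith
      · linarith
    rw [← tsum_mul_left]
    simp_rw [← tsum_mul_left]
    apply tendsto_tsum_of_dominated_convergence
      (bound := fun m : ℤ => (Real.sqrt k)⁻¹ * B * (|besselJ m x| / ‖hankelH1 m x‖ *
        (1 + (m : ℝ) ^ 2 + besP x |(m : ℝ)|))) (hsum.mul_left _)
    · intro m
      have hlim : Filter.Tendsto (fun r : ℝ => (Real.sqrt r : ℂ) *
          Complex.exp (-(Complex.I * (k : ℂ) * (r : ℂ))) * hankelH1 m (k * r)) Filter.atTop
          (nhds ((Real.sqrt k : ℂ)⁻¹ * ((Real.sqrt (2 / π) : ℂ) * e4 * (-Complex.I) ^ m))) := by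
        have hkr : Filter.Tendsto (fun r : ℝ => k * r) Filter.atTop Filter.atTop :=
          Filter.tendsto_id.const_mul_atTop hk
        have h0 : Filter.Tendsto (fun r : ℝ => (Real.sqrt (k * r) : ℂ) *
            Complex.exp (-(Complex.I * ((k * r : ℝ) : ℂ))) * hankelH1 m (k * r)) Filter.atTop
            (nhds ((Real.sqrt (2 / π) : ℂ) * e4 * (-Complex.I) ^ m)) := by
          rw [tendsto_iff_norm_sub_tendsto_zero]
          refine squeeze_zero' (Filter.Eventually.of_forall fun r => norm_nonneg _)
            (g := fun r => C * (1 + (m : ℝ) ^ 2 + besP x |(m : ℝ)|) / Real.sqrt (k * r)) ?_ ?_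
          · filter_upwards [hlarge] with r hr using hest (k * r) hr.1 m
          · exact (Real.tendsto_sqrt_atTop.comp hkr).const_div_atTop _
        refine (h0.const_mul ((Real.sqrt k : ℂ)⁻¹)).congr' ?_
        filter_upwards [hlarge] with r hr using (hterm r hr.2 m).symm
      have h1 := (hlim.const_mul (a m)).mul_const (Complex.exp (Complex.I * (m : ℂ) * (θ : ℂ)))
      convert h1 using 2
      · ring
      · rw [hc]; push_cast; field_simp
    · filter_upwards [hlarge] with r hr m
      have e1 : (Real.sqrt r : ℂ) * Complex.exp (-(Complex.I * (k : ℂ) * (r : ℂ))) *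
          (a m * hankelH1 m (k * r) * Complex.exp (Complex.I * (m : ℂ) * (θ : ℂ))) =
          (a m * Complex.exp (Complex.I * (m : ℂ) * (θ : ℂ))) * ((Real.sqrt r : ℂ) *
          Complex.exp (-(Complex.I * (k : ℂ) * (r : ℂ))) * hankelH1 m (k * r)) := by ring
      rw [e1, hterm r hr.2 m, norm_mul, norm_mul, norm_mul (_⁻¹), hexp2, mul_one, norm_inv,
        Complex.norm_real, Real.norm_of_nonneg hsk.le, han]
      have h2 := hest (k * r) hr.1 m
      set Q := 1 + (m : ℝ) ^ 2 + besP x |(m : ℝ)| with hQ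
      have hQ1 : 1 ≤ Q := by rw [hQ]; nlinarith [hPn m, sq_nonneg (m : ℝ)]
      have hmain : ‖(Real.sqrt (k * r) : ℂ) * Complex.exp (-(Complex.I * ((k * r : ℝ) : ℂ))) *
          hankelH1 m (k * r)‖ ≤ B * Q := by
        have h3 : ‖(Real.sqrt (2 / π) : ℂ) * e4 * (-Complex.I) ^ m‖ = Real.sqrt (2 / π) := by
          rw [norm_mul, norm_mul, hIm, he4n, mul_one, mul_one, Complex.norm_real,
            Real.norm_of_nonneg (by positivity)]
        have h4 := norm_le_norm_add_norm_sub' ((Real.sqrt (k * r) : ℂ) *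
          Complex.exp (-(Complex.I * ((k * r : ℝ) : ℂ))) * hankelH1 m (k * r))
          ((Real.sqrt (2 / π) : ℂ) * e4 * (-Complex.I) ^ m)
        rw [h3] at h4
        have h5 : C * Q / Real.sqrt (k * r) ≤ C * Q / Real.sqrt (2 * x) := by
          exact div_le_div_of_nonneg_left (by positivity) hs2x (Real.sqrt_le_sqrt hr.1)
        have h6 : Real.sqrt (2 / π) ≤ Real.sqrt (2 / π) * Q :=
          le_mul_of_one_le_right (by positivity) hQ1
        calc _ ≤ _ := h4
          _ ≤ Real.sqrt (2 / π) * Q + C * Q / Real.sqrt (2 * x) :=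
            add_le_add h6 (h2.trans h5)
          _ = B * Q := by rw [hB]; ring
      calc _ ≤ |besselJ m x| / ‖hankelH1 m x‖ * ((Real.sqrt k)⁻¹ * (B * Q)) := by gcongr
        _ = _ := by ring
  · have hs : ∑' m : ℤ, (-Complex.I) ^ m * a m * Complex.exp (Complex.I * (m : ℂ) * (θ : ℂ)) =
        -Complex.exp (Complex.I * (k : ℂ) *
          ((Real.cos α * x₀.1 + Real.sin α * x₀.2 : ℝ) : ℂ)) *
        ∑' m : ℤ, Complex.exp (Complex.I * (m : ℂ) * ((θ - α : ℝ) : ℂ)) *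
              (besselJ m x : ℂ) / hankelH1 m x := by
      rw [← tsum_mul_left]
      refine tsum_congr fun m => ?_
      have h1 : (-Complex.I) ^ m * Complex.I ^ m = 1 := by
        rw [← mul_zpow, neg_mul, Complex.I_mul_I, neg_neg, one_zpow]
      have h2 : Complex.exp (Complex.I * (m : ℂ) * ((θ - α : ℝ) : ℂ)) =
          Complex.exp (-(Complex.I * (m : ℂ) * (α : ℂ))) *
          Complex.exp (Complex.I * (m : ℂ) * (θ : ℂ)) := by
        rw [← Complex.exp_add]; congr 1; push_cast; ring
      rw [ha m, h2]
      linear_combination (-(Complex.exp (Complex.I * (k : ℂ) *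
        ((Real.cos α * x₀.1 + Real.sin α * x₀.2 : ℝ) : ℂ)) *
        Complex.exp (-(Complex.I * (m : ℂ) * (α : ℂ))) * (besselJ m x : ℂ) / hankelH1 m x *
        Complex.exp (Complex.I * (m : ℂ) * (θ : ℂ)))) * h1
    rw [hs]
    ring
end

section
/- For every m ∈ ℤ and every k > 0, if a, b ∈ ℂ satisfy lim_{r→∞} √r · ( d/dr [a Hₘ⁽¹⁾(kr) + b Hₘ⁽²⁾(kr)] − i k (a Hₘ⁽¹⁾(kr) + b Hₘ⁽²⁾(kr)) ) = 0, then b = 0. -/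
open Real MeasureTheory

/-- The oscillatory part. -/
noncomputable def oscA (m : ℤ) (σ : ℝ) (x : ℝ) : ℂ :=
  ∫ θ in (0:ℝ)..π, Complex.exp (((σ * (x * Real.sin θ - m * θ) : ℝ) : ℂ) * Complex.I)

/-- The monotone part. -/
noncomputable def monB (m : ℤ) (x : ℝ) : ℝ :=
  ∫ s in Set.Ioi (0:ℝ),
    (Real.exp (m * s) + (-1 : ℝ) ^ m * Real.exp (-(m * s))) * Real.exp (-x * Real.sinh s)

noncomputable def oscD (m : ℤ) (σ : ℝ) (x : ℝ) : ℂ :=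
  ∫ θ in (0:ℝ)..π, ((Real.sin θ - 1 : ℝ) : ℂ) *
    Complex.exp (((σ * (x * Real.sin θ - m * θ) : ℝ) : ℂ) * Complex.I)

lemma oscA_hasDerivAt (m : ℤ) (σ : ℝ) (x : ℝ) :
    HasDerivAt (oscA m σ) (σ * Complex.I * (oscD m σ x + oscA m σ x)) x := by
  have key := (intervalIntegral.hasDerivAt_integral_of_dominated_loc_of_deriv_le
    (μ := volume) (a := 0) (b := π) (x₀ := x) (s := Set.univ) (bound := fun _ => |σ|)
    (F := fun x θ => Complex.exp (((σ * (x * Real.sin θ - m * θ) : ℝ) : ℂ) * Complex.I))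
    (F' := fun x θ => Complex.exp (((σ * (x * Real.sin θ - m * θ) : ℝ) : ℂ) * Complex.I) *
      (((σ * (Real.sin θ) : ℝ) : ℂ) * Complex.I)) Filter.univ_mem
    (Filter.Eventually.of_forall fun x => by
      apply Continuous.aestronglyMeasurable; fun_prop)
    (by apply Continuous.intervalIntegrable; fun_prop)
    (by apply Continuous.aestronglyMeasurable; fun_prop)
    (Filter.Eventually.of_forall fun θ _ y _ => by
      rw [norm_mul, Complex.norm_exp_ofReal_mul_I, norm_mul, Complex.norm_I, Complex.norm_real,
        Real.norm_eq_abs, abs_mul]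
      have := Real.abs_sin_le_one θ
      have := abs_nonneg σ
      nlinarith)
    (by apply Continuous.intervalIntegrable; fun_prop)
    (Filter.Eventually.of_forall fun θ _ y _ => by
      apply HasDerivAt.cexp
      apply HasDerivAt.mul_const
      apply HasDerivAt.ofReal_comp
      apply HasDerivAt.const_mul
      apply HasDerivAt.sub_const
      simpa using (hasDerivAt_id y).mul_const (Real.sin θ))).2
  refine key.congr_deriv ?_
  rw [oscD, oscA, ← intervalIntegral.integral_add, ← intervalIntegral.integral_const_mul]
  · congr 1; ext θ; push_cast; ring
  · apply Continuous.intervalIntegrable; fun_prop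
  · apply Continuous.intervalIntegrable; fun_prop

lemma oscD_bound (m : ℤ) (σ : ℝ) (hσ : σ ≠ 0) :
    ∃ C : ℝ, ∀ x : ℝ, 0 < x → ‖oscD m σ x‖ ≤ C / x := by
  set E : ℝ → ℂ := fun θ => Complex.exp (((-(σ * m * θ) : ℝ) : ℂ) * Complex.I) with hE
  set g : ℝ → ℂ := fun θ => ((-Real.cos θ / (1 + Real.sin θ) : ℝ) : ℂ) * E θ with hg
  set g' : ℝ → ℂ := fun θ => ((1 / (1 + Real.sin θ) : ℝ) : ℂ) * E θ +
    ((-Real.cos θ / (1 + Real.sin θ) : ℝ) : ℂ) * (E θ * (((-(σ * m) : ℝ) : ℂ) * Complex.I)) with hg'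
  have hpos : ∀ θ ∈ Set.uIcc 0 π, 0 < 1 + Real.sin θ := by
    intro θ hθ
    rw [Set.uIcc_of_le Real.pi_pos.le] at hθ
    have := Real.sin_nonneg_of_mem_Icc hθ
    linarith
  have hEd : ∀ θ, HasDerivAt E (E θ * (((-(σ * m) : ℝ) : ℂ) * Complex.I)) θ := by
    intro θ
    apply HasDerivAt.cexp
    apply HasDerivAt.mul_const
    apply HasDerivAt.ofReal_comp
    apply HasDerivAt.neg
    simpa using (hasDerivAt_id θ).const_mul (σ * m)
  have hEc : Continuous E := by rw [hE]; fun_prop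
  have hgd : ∀ θ ∈ Set.uIcc 0 π, HasDerivAt g (g' θ) θ := by
    intro θ hθ
    have hp := hpos θ hθ
    refine HasDerivAt.mul ?_ (hEd θ)
    apply HasDerivAt.ofReal_comp
    have := ((Real.hasDerivAt_cos θ).neg).div ((Real.hasDerivAt_sin θ).const_add 1) hp.ne'
    refine this.congr_deriv ?_
    field_simp
    simp only [Pi.neg_apply]
    nlinarith [Real.sin_sq_add_cos_sq θ]
  have hg'c : ContinuousOn g' (Set.uIcc 0 π) := by
    have h1 : ContinuousOn (fun θ : ℝ => 1 / (1 + Real.sin θ)) (Set.uIcc 0 π) :=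
      ContinuousOn.div (by fun_prop) (by fun_prop) (fun θ hθ => (hpos θ hθ).ne')
    have h2 : ContinuousOn (fun θ : ℝ => -Real.cos θ / (1 + Real.sin θ)) (Set.uIcc 0 π) :=
      ContinuousOn.div (by fun_prop) (by fun_prop) (fun θ hθ => (hpos θ hθ).ne')
    have h1' := Complex.continuous_ofReal.comp_continuousOn h1
    have h2' := Complex.continuous_ofReal.comp_continuousOn h2
    exact (h1'.mul hEc.continuousOn).add (h2'.mul (hEc.mul continuous_const).continuousOn)
  have hg'i : IntervalIntegrable g' volume 0 π := hg'c.intervalIntegrable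
  refine ⟨(‖g π‖ + ‖g 0‖ + ∫ θ in (0:ℝ)..π, ‖g' θ‖) / |σ|, fun x hx => ?_⟩
  set v : ℝ → ℂ := fun θ => Complex.exp (((σ * x * Real.sin θ : ℝ) : ℂ) * Complex.I) /
    (((σ * x : ℝ) : ℂ) * Complex.I) with hv
  have hsx : ((σ * x : ℝ) : ℂ) ≠ 0 := by
    exact_mod_cast mul_ne_zero hσ hx.ne'
  have hvn : ∀ θ, ‖v θ‖ = 1 / (|σ| * x) := by
    intro θ
    rw [hv]; simp only
    rw [norm_div, Complex.norm_exp_ofReal_mul_I, norm_mul, Complex.norm_I, Complex.norm_real,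
      Real.norm_eq_abs, abs_mul, abs_of_pos hx, mul_one]
  have hvd : ∀ θ, HasDerivAt v
      (((Real.cos θ : ℝ) : ℂ) * Complex.exp (((σ * x * Real.sin θ : ℝ) : ℂ) * Complex.I)) θ := by
    intro θ
    have h : HasDerivAt (fun θ : ℝ => ((σ * x * Real.sin θ : ℝ) : ℂ) * Complex.I)
        (((σ * x * Real.cos θ : ℝ) : ℂ) * Complex.I) θ := by
      apply HasDerivAt.mul_const
      apply HasDerivAt.ofReal_comp
      exact (Real.hasDerivAt_sin θ).const_mul (σ * x)
    refine (h.cexp.div_const _).congr_deriv ?_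
    rw [div_eq_iff (mul_ne_zero hsx Complex.I_ne_zero)]
    push_cast; ring
  have ibp := intervalIntegral.integral_mul_deriv_eq_deriv_mul hgd (fun θ _ => hvd θ) hg'i
    (by apply Continuous.intervalIntegrable; fun_prop)
  have hD : oscD m σ x = g π * v π - g 0 * v 0 - ∫ θ in (0:ℝ)..π, g' θ * v θ := by
    rw [← ibp, oscD]
    apply intervalIntegral.integral_congr
    intro θ hθ
    have hp := hpos θ hθ
    have e1 : Complex.exp (((σ * (x * Real.sin θ - m * θ) : ℝ) : ℂ) * Complex.I) =
        E θ * Complex.exp (((σ * x * Real.sin θ : ℝ) : ℂ) * Complex.I) := by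
      rw [hE, ← Complex.exp_add]; congr 1; push_cast; ring
    have e2 : Real.sin θ - 1 = (-Real.cos θ / (1 + Real.sin θ)) * Real.cos θ := by
      field_simp
      nlinarith [Real.sin_sq_add_cos_sq θ]
    simp only [hg]
    rw [e1, e2, Complex.ofReal_mul]; ring
  have hI : ‖∫ θ in (0:ℝ)..π, g' θ * v θ‖ ≤ (∫ θ in (0:ℝ)..π, ‖g' θ‖) * (1 / (|σ| * x)) := by
    refine (intervalIntegral.norm_integral_le_integral_norm Real.pi_pos.le).trans (le_of_eq ?_)
    rw [← intervalIntegral.integral_mul_const]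
    congr 1; ext θ; rw [norm_mul, hvn]
  rw [hD]
  calc _ ≤ ‖g π * v π‖ + ‖g 0 * v 0‖ + ‖∫ θ in (0:ℝ)..π, g' θ * v θ‖ :=
        (norm_sub_le _ _).trans (_root_.add_le_add_left (norm_sub_le _ _) _)
    _ ≤ ‖g π‖ * (1 / (|σ| * x)) + ‖g 0‖ * (1 / (|σ| * x)) +
        (∫ θ in (0:ℝ)..π, ‖g' θ‖) * (1 / (|σ| * x)) := by
        rw [norm_mul (g π), norm_mul (g 0), hvn, hvn]; gcongr
    _ = _ := by
      have : |σ| ≠ 0 := abs_ne_zero.mpr hσ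
      field_simp

noncomputable def qf (m : ℤ) (s : ℝ) : ℝ :=
  Real.exp (m * s) + (-1 : ℝ) ^ m * Real.exp (-(m * s))

noncomputable def monC (m : ℤ) (x : ℝ) : ℝ :=
  ∫ s in Set.Ioi (0:ℝ), qf m s * (-Real.sinh s) * Real.exp (-x * Real.sinh s)

lemma qf_cont (m : ℤ) : Continuous (qf m) := by unfold qf; fun_prop

lemma qf_dom (m : ℤ) (c : ℝ) (hc : 0 < c) :
    ∃ C : ℝ, ∀ s : ℝ, 0 ≤ s →
      |qf m s| * (1 + Real.sinh s) * Real.exp (-c * Real.sinh s) ≤ C * Real.exp (-s) := by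
  set N : ℝ := |(m:ℝ)| + 1 with hN
  refine ⟨4 * Real.exp ((N + 1) ^ 2 / c), fun s hs => ?_⟩
  have h1 : |qf m s| ≤ 2 * Real.exp (|(m:ℝ)| * s) := by
    have e1 : Real.exp (m * s) ≤ Real.exp (|(m:ℝ)| * s) := by
      gcongr; exact le_abs_self _
    have e2 : Real.exp (-(m * s)) ≤ Real.exp (|(m:ℝ)| * s) := by
      rw [← neg_mul]; gcongr; exact neg_le_abs _
    have e3 : |(-1 : ℝ) ^ m| = 1 := by rw [abs_zpow]; simp
    calc |qf m s| ≤ |Real.exp (m * s)| + |(-1 : ℝ) ^ m * Real.exp (-(m * s))| := abs_add_le _ _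
      _ = Real.exp (m * s) + Real.exp (-(m * s)) := by
        rw [abs_mul, e3, Real.abs_exp, Real.abs_exp, one_mul]
      _ ≤ _ := by linarith
  have h2 : 1 + Real.sinh s ≤ 2 * Real.exp s := by
    have := Real.one_le_exp hs
    have := Real.exp_pos (-s)
    rw [Real.sinh_eq]; linarith
  have h3 : s ^ 2 / 4 ≤ Real.sinh s := by
    have := Real.quadratic_le_exp_of_nonneg hs
    have : Real.exp (-s) ≤ 1 := Real.exp_le_one_iff.mpr (by linarith)
    rw [Real.sinh_eq]; nlinarith
  have h0 : 0 ≤ Real.sinh s := Real.sinh_nonneg_iff.mpr hs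
  calc |qf m s| * (1 + Real.sinh s) * Real.exp (-c * Real.sinh s)
      ≤ (2 * Real.exp (|(m:ℝ)| * s)) * (2 * Real.exp s) * Real.exp (-c * Real.sinh s) := by
        gcongr
    _ = 4 * Real.exp (N * s - c * Real.sinh s) := by
        rw [show N * s - c * Real.sinh s = |(m:ℝ)| * s + s + (-c * Real.sinh s) by rw [hN]; ring,
          Real.exp_add, Real.exp_add]; ring
    _ ≤ 4 * Real.exp ((N + 1) ^ 2 / c + -s) := by
        gcongr
        have : N * s - c * (s ^ 2 / 4) ≤ (N + 1) ^ 2 / c + -s := by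
          have : (N + 1) ^ 2 / c + -s - (N * s - c * (s ^ 2 / 4)) =
            ((N + 1) - c * s / 2) ^ 2 / c := by field_simp; ring
          have : 0 ≤ ((N + 1) - c * s / 2) ^ 2 / c := by positivity
          linarith
        nlinarith
    _ = _ := by rw [Real.exp_add]; ring

lemma exp_int (x : ℝ) (hx : 0 < x) : IntegrableOn (fun s : ℝ => Real.exp (-x * s)) (Set.Ioi 0) :=
  integrableOn_exp_mul_Ioi (by linarith) 0

lemma qf_bd (m : ℤ) : ∃ C : ℝ, ∀ x : ℝ, 1 ≤ x → ∀ s : ℝ, 0 ≤ s →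
      |qf m s| * (1 + Real.sinh s) * Real.exp (-x * Real.sinh s) ≤ C * Real.exp (-x * s) := by
  obtain ⟨C, hC⟩ := qf_dom m 1 one_pos
  refine ⟨C, fun x hx s hs => ?_⟩
  have h0 : 0 ≤ Real.sinh s := Real.sinh_nonneg_iff.mpr hs
  have h1 : s ≤ Real.sinh s := Real.self_le_sinh_iff.mpr hs
  calc _ = |qf m s| * (1 + Real.sinh s) * Real.exp (-1 * Real.sinh s)
        * Real.exp (-(x - 1) * Real.sinh s) := by
        rw [mul_assoc _ (Real.exp _) (Real.exp _), ← Real.exp_add]; congr 2; ring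
    _ ≤ |qf m s| * (1 + Real.sinh s) * Real.exp (-1 * Real.sinh s)
        * Real.exp (-(x - 1) * s) := by
        gcongr _ * Real.exp ?_
        nlinarith
    _ ≤ C * Real.exp (-s) * Real.exp (-(x - 1) * s) := by
        exact mul_le_mul_of_nonneg_right (hC s hs) (Real.exp_pos _).le
    _ = _ := by rw [mul_assoc, ← Real.exp_add]; congr 2; ring

lemma mon_bound (m : ℤ) : ∃ C : ℝ, ∀ x : ℝ, 1 ≤ x → |monB m x| ≤ C / x ∧ |monC m x| ≤ C / x := by
  obtain ⟨C, hC⟩ := qf_bd m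
  refine ⟨C, fun x hx => ?_⟩
  have hx0 : 0 < x := by linarith
  have hI : ∫ s in Set.Ioi (0:ℝ), C * Real.exp (-x * s) = C / x := by
    rw [integral_const_mul, integral_exp_mul_Ioi (by linarith)]
    simp [div_eq_mul_inv]
  constructor
  · rw [← hI, ← Real.norm_eq_abs]
    refine norm_integral_le_of_norm_le ((exp_int x hx0).const_mul C) ?_
    refine (ae_restrict_iff' measurableSet_Ioi).mpr (Filter.Eventually.of_forall fun s hs => ?_)
    have hs' : (0:ℝ) ≤ s := le_of_lt hs
    refine le_trans ?_ (hC x hx s hs')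
    have h0 : 0 ≤ Real.sinh s := Real.sinh_nonneg_iff.mpr hs'
    change ‖qf m s * _‖ ≤ _
    rw [norm_mul, Real.norm_eq_abs, Real.norm_eq_abs, Real.abs_exp]
    gcongr
    nlinarith [abs_nonneg (qf m s)]
  · rw [← hI, ← Real.norm_eq_abs]
    refine norm_integral_le_of_norm_le ((exp_int x hx0).const_mul C) ?_
    refine (ae_restrict_iff' measurableSet_Ioi).mpr (Filter.Eventually.of_forall fun s hs => ?_)
    have hs' : (0:ℝ) ≤ s := le_of_lt hs
    refine le_trans ?_ (hC x hx s hs')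
    have h0 : 0 ≤ Real.sinh s := Real.sinh_nonneg_iff.mpr hs'
    rw [norm_mul, norm_mul, norm_neg, Real.norm_eq_abs, Real.norm_eq_abs, Real.norm_eq_abs,
      Real.abs_exp, abs_of_nonneg h0]
    gcongr
    linarith

lemma monB_hasDerivAt (m : ℤ) (x : ℝ) (hx : 0 < x) :
    HasDerivAt (monB m) (monC m x) x := by
  obtain ⟨C, hC⟩ := qf_dom m (x / 2) (by linarith)
  have hqc := qf_cont m
  have hCi : IntegrableOn (fun s : ℝ => C * Real.exp (-s)) (Set.Ioi 0) :=
    (integrableOn_exp_neg_Ioi 0).const_mul C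
  have hbase : ∀ y : ℝ, x / 2 < y → ∀ s : ℝ, 0 < s →
      |qf m s| * (1 + Real.sinh s) * Real.exp (-y * Real.sinh s) ≤ C * Real.exp (-s) := by
    intro y hy s hs
    have h0 : 0 ≤ Real.sinh s := Real.sinh_nonneg_iff.mpr hs.le
    refine le_trans ?_ (hC s hs.le)
    gcongr
  refine (hasDerivAt_integral_of_dominated_loc_of_deriv_le
    (μ := volume.restrict (Set.Ioi (0:ℝ))) (x₀ := x) (s := Set.Ioi (x / 2))
    (bound := fun s => C * Real.exp (-s))
    (F := fun x s => qf m s * Real.exp (-x * Real.sinh s))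
    (F' := fun x s => qf m s * (-Real.sinh s) * Real.exp (-x * Real.sinh s))
    (Ioi_mem_nhds (by linarith))
    (Filter.Eventually.of_forall fun y => by
      apply Continuous.aestronglyMeasurable; fun_prop) ?_
    (by apply Continuous.aestronglyMeasurable; fun_prop) ?_ hCi ?_).2
  · refine Integrable.mono' hCi (by apply Continuous.aestronglyMeasurable; fun_prop) ?_
    refine (ae_restrict_iff' measurableSet_Ioi).mpr (Filter.Eventually.of_forall fun s hs => ?_)
    refine le_trans ?_ (hbase x (by linarith) s hs)
    have h0 : 0 ≤ Real.sinh s := Real.sinh_nonneg_iff.mpr (le_of_lt hs)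
    rw [norm_mul, Real.norm_eq_abs, Real.norm_eq_abs, Real.abs_exp]
    gcongr
    nlinarith [abs_nonneg (qf m s)]
  · refine (ae_restrict_iff' measurableSet_Ioi).mpr
      (Filter.Eventually.of_forall fun s hs y hy => ?_)
    refine le_trans ?_ (hbase y hy s hs)
    have h0 : 0 ≤ Real.sinh s := Real.sinh_nonneg_iff.mpr (le_of_lt hs)
    rw [norm_mul, norm_mul, norm_neg, Real.norm_eq_abs, Real.norm_eq_abs, Real.norm_eq_abs,
      Real.abs_exp, abs_of_nonneg h0]
    gcongr
    linarith
  · refine Filter.Eventually.of_forall fun s y hy => ?_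
    have h : HasDerivAt (fun y : ℝ => -y * Real.sinh s) (-Real.sinh s) y := by
      simpa using (hasDerivAt_id y).neg.mul_const (Real.sinh s)
    refine (h.exp.const_mul (qf m s)).congr_deriv ?_
    ring

lemma oscA_eq (m : ℤ) (σ x : ℝ) : oscA m σ x =
    ((∫ θ in (0:ℝ)..π, Real.cos (σ * (x * Real.sin θ - m * θ)) : ℝ) : ℂ) +
    Complex.I * ((∫ θ in (0:ℝ)..π, Real.sin (σ * (x * Real.sin θ - m * θ)) : ℝ) : ℂ) := by
  rw [oscA, ← intervalIntegral.integral_ofReal, ← intervalIntegral.integral_ofReal,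
    ← intervalIntegral.integral_const_mul, ← intervalIntegral.integral_add]
  · congr 1; ext θ
    rw [Complex.exp_mul_I, ← Complex.ofReal_cos, ← Complex.ofReal_sin, mul_comm Complex.I]
  · apply Continuous.intervalIntegrable; fun_prop
  · apply Continuous.intervalIntegrable; fun_prop

lemma hankelH1_eq (m : ℤ) (x : ℝ) :
    hankelH1 m x = (1 / (π : ℂ)) * (oscA m 1 x - Complex.I * (monB m x : ℂ)) := by
  have e : ∀ θ : ℝ, Real.cos (m * θ - x * Real.sin θ) = Real.cos (x * Real.sin θ - m * θ) := by
    intro θ; rw [← Real.cos_neg]; congr 1; ring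
  rw [oscA_eq, hankelH1, besselJ, besselY, monB]
  simp only [e, one_mul]
  push_cast; ring

lemma hankelH2_eq (m : ℤ) (x : ℝ) :
    hankelH2 m x = (1 / (π : ℂ)) * (oscA m (-1) x + Complex.I * (monB m x : ℂ)) := by
  have e : ∀ θ : ℝ, Real.cos (m * θ - x * Real.sin θ) = Real.cos (x * Real.sin θ - m * θ) := by
    intro θ; rw [← Real.cos_neg]; congr 1; ring
  rw [oscA_eq, hankelH2, besselJ, besselY, monB]
  simp only [e, neg_mul, one_mul, Real.cos_neg, Real.sin_neg, intervalIntegral.integral_neg]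
  push_cast; ring

noncomputable def Rf (m : ℤ) (x : ℝ) : ℝ :=
  ∫ φ in (0:ℝ)..(π/2), Real.cos (m * φ) * Real.cos (x * (1 - Real.cos φ))

lemma Rf_le (m : ℤ) (x : ℝ) : 2 * |Rf m x| ≤ ‖oscA m (-1) x‖ := by
  set f : ℝ → ℂ := fun θ => Complex.exp (((-1 * (x * Real.sin θ - m * θ) : ℝ) : ℂ) * Complex.I)
    with hf
  have hfc : Continuous f := by rw [hf]; fun_prop
  have h1 : oscA m (-1) x = ∫ φ in (0:ℝ)..(π/2), (f (π/2 - φ) + f (π/2 + φ)) := by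
    rw [intervalIntegral.integral_add, intervalIntegral.integral_comp_sub_left,
      intervalIntegral.integral_comp_add_left]
    · rw [sub_self, sub_zero, add_zero, add_halves,
        intervalIntegral.integral_add_adjacent_intervals (hfc.intervalIntegrable _ _)
        (hfc.intervalIntegrable _ _)]
      rfl
    · apply Continuous.intervalIntegrable; fun_prop
    · apply Continuous.intervalIntegrable; fun_prop
  have h2 : Complex.exp (((x - m * (π/2) : ℝ) : ℂ) * Complex.I) * oscA m (-1) x =
      ((∫ φ in (0:ℝ)..(π/2), 2 * (Real.cos (m * φ) * Real.cos (x * (1 - Real.cos φ))) : ℝ) : ℂ)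
      + ((∫ φ in (0:ℝ)..(π/2), 2 * (Real.cos (m * φ) * Real.sin (x * (1 - Real.cos φ))) : ℝ) : ℂ)
        * Complex.I := by
    rw [h1, ← intervalIntegral.integral_ofReal, ← intervalIntegral.integral_ofReal,
      ← intervalIntegral.integral_const_mul, ← intervalIntegral.integral_mul_const,
      ← intervalIntegral.integral_add]
    · congr 1; ext φ
      have e1 : Complex.exp (((x - m * (π/2) : ℝ) : ℂ) * Complex.I) * f (π/2 - φ) =
          Complex.exp (((x * (1 - Real.cos φ) : ℝ) : ℂ) * Complex.I) *
          Complex.exp (((-(m * φ) : ℝ) : ℂ) * Complex.I) := by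
        simp only [hf]
        rw [Real.sin_pi_div_two_sub, ← Complex.exp_add, ← Complex.exp_add]
        congr 1; push_cast; ring
      have e2 : Complex.exp (((x - m * (π/2) : ℝ) : ℂ) * Complex.I) * f (π/2 + φ) =
          Complex.exp (((x * (1 - Real.cos φ) : ℝ) : ℂ) * Complex.I) *
          Complex.exp (((m * φ : ℝ) : ℂ) * Complex.I) := by
        simp only [hf]
        rw [add_comm (π/2) φ, Real.sin_add_pi_div_two, ← Complex.exp_add, ← Complex.exp_add]
        congr 1; push_cast; ring
      rw [mul_add, e1, e2]
      simp only [Complex.exp_mul_I, ← Complex.ofReal_cos, ← Complex.ofReal_sin, Real.cos_neg,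
        Real.sin_neg]
      push_cast; ring
    · apply Continuous.intervalIntegrable; fun_prop
    · apply Continuous.intervalIntegrable; fun_prop
  have h3 := congrArg Complex.re h2
  simp only [Complex.add_re, Complex.ofReal_re, Complex.mul_re, Complex.I_re, Complex.I_im,
    Complex.ofReal_im, intervalIntegral.integral_const_mul] at h3
  have h4 : (Complex.exp (((x - m * (π/2) : ℝ) : ℂ) * Complex.I) * oscA m (-1) x).re = 2 * Rf m x := by
    rw [Complex.mul_re, h3, Rf]; ring
  calc 2 * |Rf m x| = |2 * Rf m x| := by rw [abs_mul]; simp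
    _ ≤ ‖Complex.exp (((x - m * (π/2) : ℝ) : ℂ) * Complex.I) * oscA m (-1) x‖ := by
      rw [← h4]; exact Complex.abs_re_le_norm _
    _ = _ := by rw [norm_mul, Complex.norm_exp_ofReal_mul_I, one_mul]

lemma laplace_cos (ε c : ℝ) (hε : 0 < ε) :
    ∫ x in Set.Ioi (0:ℝ), Real.cos (x * c) * Real.exp (-ε * x) = ε / (ε ^ 2 + c ^ 2) := by
  have hre : ((-ε : ℂ) + c * Complex.I).re < 0 := by simpa using hε
  have h := integral_exp_mul_complex_Ioi hre 0
  have hi := integrableOn_exp_mul_complex_Ioi hre 0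
  have h2 := congrArg Complex.re h
  have h3 : (∫ x in Set.Ioi (0:ℝ), Complex.exp (((-ε : ℂ) + c * Complex.I) * x)).re =
      ∫ x in Set.Ioi (0:ℝ), (Complex.exp (((-ε : ℂ) + c * Complex.I) * x)).re :=
    (Complex.reCLM.integral_comp_comm hi).symm
  rw [h3] at h2
  have h4 : ∀ x : ℝ, (Complex.exp (((-ε : ℂ) + c * Complex.I) * x)).re =
      Real.cos (x * c) * Real.exp (-ε * x) := by
    intro x
    rw [Complex.exp_re]; simp; ring_nf
  simp only [h4] at h2
  rw [h2]
  have : ε ^ 2 + c ^ 2 ≠ 0 := by positivity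
  simp [Complex.div_re, Complex.normSq_apply]
  congr 1; ring

lemma Rf_laplace (m : ℤ) (ε : ℝ) (hε : 0 < ε) :
    ∫ x in Set.Ioi (0:ℝ), Rf m x * Real.exp (-ε * x) =
      ∫ φ in (0:ℝ)..(π/2), Real.cos (m * φ) * (ε / (ε ^ 2 + (1 - Real.cos φ) ^ 2)) := by
  have e1 : ∀ x : ℝ, Rf m x * Real.exp (-ε * x) = ∫ φ in (0:ℝ)..(π/2),
      Real.cos (m * φ) * Real.cos (x * (1 - Real.cos φ)) * Real.exp (-ε * x) := by
    intro x; rw [Rf, intervalIntegral.integral_mul_const]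
  simp only [e1]
  rw [← intervalIntegral_integral_swap]
  · congr 1; ext φ
    rw [← laplace_cos ε _ hε, ← integral_const_mul]
    congr 1; ext x; ring
  · have : Integrable (fun z : ℝ × ℝ => (1:ℝ) * Real.exp (-ε * z.2))
        ((volume.restrict (Set.uIoc 0 (π/2))).prod (volume.restrict (Set.Ioi (0:ℝ)))) := by
      refine Integrable.mul_prod (f := fun _ => (1:ℝ)) ?_ (exp_int ε hε)
      rw [integrable_const_iff]; right
      constructor; simp
    refine this.mono' ?_ ?_
    · apply Continuous.aestronglyMeasurable
      unfold Function.uncurry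
      fun_prop
    · refine Filter.Eventually.of_forall fun z => ?_
      simp only [Function.uncurry]
      rw [norm_mul, norm_mul, Real.norm_eq_abs, Real.norm_eq_abs, Real.norm_eq_abs, Real.abs_exp]
      gcongr
      have h1 := Real.abs_cos_le_one (m * z.1)
      have h2 := Real.abs_cos_le_one (z.2 * (1 - Real.cos z.1))
      have := abs_nonneg (Real.cos (m * z.1))
      have := abs_nonneg (Real.cos (z.2 * (1 - Real.cos z.1)))
      nlinarith

lemma lower (m : ℤ) : ∃ K t₀ : ℝ, 0 < t₀ ∧ ∀ t : ℝ, 0 < t → t ≤ t₀ →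
    1 / (4 * t) - K ≤
      ∫ φ in (0:ℝ)..(π/2), Real.cos (m * φ) * (t^2 / ((t^2) ^ 2 + (1 - Real.cos φ) ^ 2)) := by
  set δ : ℝ := 1 / (|(m:ℝ)| + 1) with hδ
  have hm := abs_nonneg (m:ℝ)
  have hδ0 : 0 < δ := by positivity
  have hδ1 : δ ≤ 1 := by rw [hδ, div_le_one (by positivity)]; linarith
  have hmδ : |(m:ℝ)| * δ ≤ 1 := by rw [hδ, mul_one_div, div_le_one (by positivity)]; linarith
  have hpi := Real.pi_gt_three
  have hcδ : 0 < 1 - Real.cos δ := by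
    have := Real.cos_lt_cos_of_nonneg_of_le_pi_div_two le_rfl (by linarith : δ ≤ π/2) hδ0
    rw [Real.cos_zero] at this; linarith
  have hcos : ∀ φ, 0 ≤ φ → φ ≤ δ → 1/2 ≤ Real.cos (m * φ) := by
    intro φ h0 h1
    have := Real.one_sub_sq_div_two_le_cos (x := m * φ)
    have h2 : |(m:ℝ) * φ| ≤ 1 := by
      rw [abs_mul, abs_of_nonneg h0]
      exact le_trans (by gcongr) hmδ
    have h3 : ((m:ℝ) * φ) ^ 2 ≤ 1 := (sq_le_one_iff_abs_le_one _).mpr h2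
    linarith
  set K : ℝ := 1 / (1 - Real.cos δ) ^ 2 with hK
  have hK0 : 0 < K := by positivity
  refine ⟨π / 2 * K, δ, hδ0, fun t ht htδ => ?_⟩
  set F : ℝ → ℝ := fun φ => Real.cos (m * φ) * (t^2 / ((t^2) ^ 2 + (1 - Real.cos φ) ^ 2)) with hF
  have hFc : Continuous F := by
    rw [hF]
    refine Continuous.mul (by fun_prop) (Continuous.div (by fun_prop) (by fun_prop) ?_)
    intro φ; positivity
  have htp : t ≤ π / 2 := by linarith
  rw [← intervalIntegral.integral_add_adjacent_intervals (hFc.intervalIntegrable 0 t)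
    (hFc.intervalIntegrable t (π/2))]
  have p1 : 1 / (4 * t) ≤ ∫ φ in (0:ℝ)..t, F φ := by
    have h : ∫ φ in (0:ℝ)..t, (1 / (4 * t^2)) ≤ ∫ φ in (0:ℝ)..t, F φ := by
      refine intervalIntegral.integral_mono_on ht.le (by simp)
        (hFc.intervalIntegrable 0 t) ?_
      intro φ hφ
      have h1 := hcos φ hφ.1 (hφ.2.trans htδ)
      have h2 := Real.one_sub_sq_div_two_le_cos (x := φ)
      have h3 := Real.cos_le_one φ
      have h4 : φ ^ 2 ≤ t ^ 2 := by have := hφ.1; have := hφ.2; gcongr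
      have h5 : (1 - Real.cos φ) ^ 2 ≤ (t^2) ^ 2 := by
        apply pow_le_pow_left₀ <;> nlinarith
      have h6 : 1 / (2 * t^2) ≤ t^2 / ((t^2) ^ 2 + (1 - Real.cos φ) ^ 2) := by
        rw [div_le_div_iff₀ (by positivity) (by positivity)]
        nlinarith
      calc 1 / (4 * t^2) = 1/2 * (1 / (2 * t^2)) := by field_simp; norm_num
        _ ≤ F φ := by simp only [hF]; gcongr
    refine le_trans (le_of_eq ?_) h
    rw [intervalIntegral.integral_const]; simp; field_simp
  have p2 : -(π / 2 * K) ≤ ∫ φ in t..(π/2), F φ := by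
    have h : ∫ φ in t..(π/2), (-K) ≤ ∫ φ in t..(π/2), F φ := by
      refine intervalIntegral.integral_mono_on htp (by simp)
        (hFc.intervalIntegrable _ _) ?_
      intro φ hφ
      have hφ0 : 0 ≤ φ := ht.le.trans hφ.1
      rcases le_total φ δ with h | h
      · have := hcos φ hφ0 h
        have : 0 ≤ F φ := by simp only [hF]; positivity
        linarith
      · have h1 : Real.cos φ ≤ Real.cos δ :=
          Real.cos_le_cos_of_nonneg_of_le_pi hδ0.le (by linarith [hφ.2]) h
        have h2 : t^2 / ((t^2) ^ 2 + (1 - Real.cos φ) ^ 2) ≤ K := by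
          rw [hK]
          apply div_le_div₀ zero_le_one _ (by positivity)
          · have : (1 - Real.cos δ) ^ 2 ≤ (1 - Real.cos φ) ^ 2 := by gcongr
            nlinarith [sq_nonneg (t^2)]
          · nlinarith
        have h3 := Real.neg_one_le_cos (m * φ)
        have h4 : 0 ≤ t^2 / ((t^2) ^ 2 + (1 - Real.cos φ) ^ 2) := by positivity
        simp only [hF]
        nlinarith
    refine le_trans ?_ h
    rw [intervalIntegral.integral_const]; simp
    nlinarith
  linarith

lemma Rf_abs_le (m : ℤ) (x : ℝ) : |Rf m x| ≤ 2 := by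
  have h := intervalIntegral.norm_integral_le_of_norm_le_const (a := 0) (b := π/2) (C := 1)
    (f := fun φ : ℝ => Real.cos (m * φ) * Real.cos (x * (1 - Real.cos φ))) (by
      intro φ _
      rw [norm_mul, Real.norm_eq_abs, Real.norm_eq_abs]
      exact mul_le_one₀ (Real.abs_cos_le_one _) (abs_nonneg _) (Real.abs_cos_le_one _))
  rw [← Rf, Real.norm_eq_abs, sub_zero, abs_of_pos (show (0:ℝ) < π / 2 by positivity)] at h
  linarith [Real.pi_lt_four]

lemma no_decay (m : ℤ)
    (h : Filter.Tendsto (fun x : ℝ => Real.sqrt x * ‖oscA m (-1) x‖) Filter.atTop (nhds 0)) :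
    False := by
  have hev := h.eventually (gt_mem_nhds (show (0:ℝ) < 1/8 by norm_num))
  obtain ⟨X₀, hX₀⟩ := Filter.eventually_atTop.mp hev
  set X := max X₀ 1 with hX
  have hX1 : 1 ≤ X := le_max_right _ _
  have hR : ∀ x, X < x → |Rf m x| ≤ 1/16 * x ^ ((1/2:ℝ) - 1) := by
    intro x hx
    have h1 := hX₀ x ((le_max_left _ _).trans hx.le)
    have hx0 : 0 < x := by linarith
    have h2 := Rf_le m x
    have hs : 0 < Real.sqrt x := Real.sqrt_pos.mpr hx0
    have e : x ^ ((1/2:ℝ) - 1) = (Real.sqrt x)⁻¹ := by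
      rw [show (1/2:ℝ) - 1 = -(1/2) by norm_num, Real.rpow_neg hx0.le, Real.sqrt_eq_rpow]
    rw [e, ← div_eq_mul_inv, le_div_iff₀ hs]
    nlinarith
  obtain ⟨K, t₀, ht₀, hlow⟩ := lower m
  have key : ∀ t : ℝ, 0 < t → t ≤ t₀ → 1 / (8 * t) ≤ K + 2 * X := by
    intro t ht htt
    have hl := hlow t ht htt
    rw [← Rf_laplace m (t^2) (by positivity)] at hl
    have hG := Real.integral_rpow_mul_exp_neg_mul_Ioi (a := 1/2) (r := t^2) (by norm_num)
      (by positivity)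
    rw [Real.Gamma_one_half_eq] at hG
    have hGe : ((1 / t^2) ^ (1/2:ℝ) : ℝ) = 1 / t := by
      rw [← Real.sqrt_eq_rpow, show 1 / t^2 = (1/t)^2 by ring, Real.sqrt_sq (by positivity)]
    rw [hGe] at hG
    have hGi : IntegrableOn (fun x : ℝ => x ^ ((1/2:ℝ) - 1) * Real.exp (-(t^2 * x))) (Set.Ioi 0) :=
      .of_integral_ne_zero (by rw [hG]; positivity)
    have hIi : Integrable (Set.indicator (Set.Ioc 0 X) (fun _ => (2:ℝ)))
        (volume.restrict (Set.Ioi 0)) := by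
      apply Integrable.restrict
      rw [integrable_indicator_iff measurableSet_Ioc]
      simp
    have hIv : ∫ x in Set.Ioi (0:ℝ), Set.indicator (Set.Ioc 0 X) (fun _ => (2:ℝ)) x = 2 * X := by
      rw [setIntegral_indicator measurableSet_Ioc,
        Set.inter_eq_right.mpr Set.Ioc_subset_Ioi_self, setIntegral_const]
      simp only [Measure.real, Real.volume_Ioc, sub_zero, smul_eq_mul]
      rw [ENNReal.toReal_ofReal (by linarith)]; ring
    have hup : ‖∫ x in Set.Ioi (0:ℝ), Rf m x * Real.exp (-t^2 * x)‖ ≤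
        ∫ x in Set.Ioi (0:ℝ), (Set.indicator (Set.Ioc 0 X) (fun _ => (2:ℝ)) x +
          1/16 * (x ^ ((1/2:ℝ) - 1) * Real.exp (-(t^2 * x)))) := by
      refine norm_integral_le_of_norm_le (hIi.add (hGi.const_mul _)) ?_
      refine (ae_restrict_iff' measurableSet_Ioi).mpr (Filter.Eventually.of_forall fun x hx => ?_)
      have hx0 : (0:ℝ) < x := hx
      have hee : Real.exp (-t^2 * x) ≤ 1 := by
        apply Real.exp_le_one_iff.mpr
        have : 0 < t^2 * x := by positivity
        linarith
      rw [norm_mul, Real.norm_eq_abs, Real.norm_eq_abs, Real.abs_exp]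
      have hp := Real.rpow_nonneg hx0.le ((1/2:ℝ) - 1)
      rcases le_or_gt x X with hxX | hxX
      · rw [Set.indicator_of_mem (show x ∈ Set.Ioc 0 X from ⟨hx0, hxX⟩)]
        have h1 := Rf_abs_le m x
        have h2 : 0 ≤ 1/16 * (x ^ ((1/2:ℝ) - 1) * Real.exp (-(t^2 * x))) := by positivity
        have h3 : |Rf m x| * Real.exp (-t^2 * x) ≤ 2 * 1 := by gcongr
        linarith
      · rw [Set.indicator_of_notMem (fun hh => absurd hh.2 (not_le.mpr hxX)), zero_add,
          ← mul_assoc, neg_mul]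
        gcongr
        exact hR x hxX
    rw [integral_add hIi (hGi.const_mul _), integral_const_mul, hG, hIv, Real.norm_eq_abs] at hup
    have h1 := (le_abs_self _).trans hup
    have hsp : Real.sqrt π ≤ 2 := by
      rw [Real.sqrt_le_left (by norm_num)]
      linarith [Real.pi_lt_four]
    have h2 : 1/16 * (1 / t * Real.sqrt π) ≤ 1 / (8 * t) := by
      calc 1/16 * (1 / t * Real.sqrt π) ≤ 1/16 * (1 / t * 2) := by gcongr
        _ = _ := by field_simp; norm_num
    have h3 : 1 / (4 * t) = 2 * (1 / (8 * t)) := by field_simp; norm_num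
    linarith
  set M := |K| + 2 * X + 1 with hM
  have hM0 : 0 < M := by positivity
  have hk := key (min t₀ (1 / (8 * M))) (lt_min ht₀ (by positivity)) (min_le_left _ _)
  have h5 : M ≤ 1 / (8 * min t₀ (1 / (8 * M))) := by
    have hmin : 0 < min t₀ (1 / (8 * M)) := lt_min ht₀ (by positivity)
    rw [le_div_iff₀ (by positivity)]
    have : min t₀ (1 / (8 * M)) ≤ 1 / (8 * M) := min_le_right _ _
    calc M * (8 * min t₀ (1 / (8 * M))) ≤ M * (8 * (1 / (8 * M))) := by gcongr
      _ = 1 := by field_simp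
  have := le_abs_self K
  linarith

noncomputable def errT (m : ℤ) (a b : ℂ) (x : ℝ) : ℂ :=
  a * (Complex.I * oscD m 1 x - Complex.I * (monC m x : ℂ) - (monB m x : ℂ)) +
  b * (-(Complex.I * oscD m (-1) x) + Complex.I * (monC m x : ℂ) + (monB m x : ℂ))

lemma errT_bound (m : ℤ) (a b : ℂ) : ∃ M : ℝ, ∀ x : ℝ, 1 ≤ x → ‖errT m a b x‖ ≤ M / x := by
  obtain ⟨C1, h1⟩ := oscD_bound m 1 one_ne_zero
  obtain ⟨C2, h2⟩ := oscD_bound m (-1) (by norm_num)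
  obtain ⟨C3, h3⟩ := mon_bound m
  refine ⟨‖a‖ * (C1 + C3 + C3) + ‖b‖ * (C2 + C3 + C3), fun x hx => ?_⟩
  have hx0 : 0 < x := by linarith
  have d1 := h1 x hx0
  have d2 := h2 x hx0
  obtain ⟨d3, d4⟩ := h3 x hx
  have n1 : ‖Complex.I * oscD m 1 x - Complex.I * (monC m x : ℂ) - (monB m x : ℂ)‖ ≤
      (C1 + C3 + C3) / x := by
    refine (norm_sub_le _ _).trans ((_root_.add_le_add_left (norm_sub_le _ _) _).trans ?_)
    simp only [norm_mul, Complex.norm_I, Complex.norm_real, Real.norm_eq_abs, one_mul, add_div]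
    linarith
  have n2 : ‖-(Complex.I * oscD m (-1) x) + Complex.I * (monC m x : ℂ) + (monB m x : ℂ)‖ ≤
      (C2 + C3 + C3) / x := by
    refine (norm_add_le _ _).trans ((_root_.add_le_add_left (norm_add_le _ _) _).trans ?_)
    simp only [norm_neg, norm_mul, Complex.norm_I, Complex.norm_real, Real.norm_eq_abs, one_mul,
      add_div]
    linarith
  calc ‖errT m a b x‖ ≤ ‖a‖ * ((C1 + C3 + C3) / x) + ‖b‖ * ((C2 + C3 + C3) / x) := by
        refine (norm_add_le _ _).trans ?_
        rw [norm_mul, norm_mul]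
        gcongr
    _ = _ := by ring

lemma rad_eq (m : ℤ) (k : ℝ) (hk : 0 < k) (a b : ℂ) (r : ℝ) (hr : 0 < r) :
    deriv (fun s : ℝ => a * hankelH1 m (k * s) + b * hankelH2 m (k * s)) r
      - Complex.I * (k : ℂ) * (a * hankelH1 m (k * r) + b * hankelH2 m (k * r)) =
    (k / π : ℂ) * (-2 * Complex.I * b * oscA m (-1) (k * r) + errT m a b (k * r)) := by
  have hx : 0 < k * r := by positivity
  have hin : HasDerivAt (fun s : ℝ => k * s) k r := by
    simpa using (hasDerivAt_id r).const_mul k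
  have dA1 := (oscA_hasDerivAt m 1 (k * r)).scomp r hin
  have dA2 := (oscA_hasDerivAt m (-1) (k * r)).scomp r hin
  have dB := ((monB_hasDerivAt m (k * r) hx).ofReal_comp).scomp r hin
  have d1 := ((dA1.sub (dB.const_mul Complex.I)).const_mul (1 / (π : ℂ))).const_mul a
  have d2 := ((dA2.add (dB.const_mul Complex.I)).const_mul (1 / (π : ℂ))).const_mul b
  have d := d1.add d2
  have hfun : (fun s : ℝ => a * hankelH1 m (k * s) + b * hankelH2 m (k * s)) = fun s : ℝ =>
      a * ((1 / (π : ℂ)) * (oscA m 1 (k * s) - Complex.I * (monB m (k * s) : ℂ))) +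
      b * ((1 / (π : ℂ)) * (oscA m (-1) (k * s) + Complex.I * (monB m (k * s) : ℂ))) := by
    ext s; rw [hankelH1_eq, hankelH2_eq]
  have d' := HasDerivAt.deriv d
  rw [hfun]
  refine (congrArg₂ (· - ·) d' rfl).trans ?_
  rw [hankelH1_eq, hankelH2_eq, errT]
  simp only [Complex.real_smul]
  push_cast
  ring_nf
  simp only [Complex.I_sq]
  ring

/-- A single angular mode `a H_m^{(1)}(kr) + b H_m^{(2)}(kr)` satisfying the Sommerfeld
radiation condition cannot contain a Hankel function of the second kind: `b = 0`. -/
theorem radiation_condition_no_H2 (m : ℤ) (k : ℝ) (hk : 0 < k) (a b : ℂ)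
    (hrad : Filter.Tendsto
      (fun r : ℝ => (Real.sqrt r : ℂ) *
        (deriv (fun s : ℝ => a * hankelH1 m (k * s) + b * hankelH2 m (k * s)) r
          - Complex.I * (k : ℂ) * (a * hankelH1 m (k * r) + b * hankelH2 m (k * r))))
      Filter.atTop (nhds 0)) :
    b = 0 := by
  by_contra hb
  obtain ⟨M, hM⟩ := errT_bound m a b
  apply no_decay m
  have hkc : (k : ℂ) ≠ 0 := by exact_mod_cast hk.ne'
  have hpc : (π : ℂ) ≠ 0 := by exact_mod_cast Real.pi_ne_zero
  -- the error term decays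
  have herr : Filter.Tendsto (fun r : ℝ => (Real.sqrt r : ℂ) * errT m a b (k * r))
      Filter.atTop (nhds 0) := by
    have hz : Filter.Tendsto (fun r : ℝ => (M / k) * (Real.sqrt r)⁻¹) Filter.atTop (nhds 0) := by
      simpa using (Filter.Tendsto.inv_tendsto_atTop Real.tendsto_sqrt_atTop).const_mul (M / k)
    refine squeeze_zero_norm' ?_ hz
    filter_upwards [Filter.eventually_ge_atTop (1 / k), Filter.eventually_gt_atTop 0] with r hr hr0
    have h1 : 1 ≤ k * r := by rwa [div_le_iff₀' hk] at hr
    have hs : 0 < Real.sqrt r := Real.sqrt_pos.mpr hr0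
    rw [norm_mul, Complex.norm_real, Real.norm_eq_abs, abs_of_pos hs]
    calc Real.sqrt r * ‖errT m a b (k * r)‖ ≤ Real.sqrt r * (M / (k * r)) := by
          gcongr; exact hM _ h1
      _ = Real.sqrt r * (M / (k * (Real.sqrt r * Real.sqrt r))) := by
          rw [Real.mul_self_sqrt hr0.le]
      _ = _ := by field_simp
  have h2 : Filter.Tendsto (fun r : ℝ => (Real.sqrt r : ℂ) * oscA m (-1) (k * r))
      Filter.atTop (nhds 0) := by
    have h3 := ((hrad.const_mul ((π : ℂ) / k)).sub herr).const_mul ((-2 * Complex.I * b)⁻¹)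
    simp only [mul_zero, sub_zero] at h3
    refine h3.congr' ?_
    filter_upwards [Filter.eventually_gt_atTop 0] with r hr0
    rw [rad_eq m k hk a b r hr0]
    have hI := Complex.I_ne_zero
    field_simp
    ring
  have h4 : Filter.Tendsto (fun x : ℝ => x / k) Filter.atTop Filter.atTop :=
    Filter.tendsto_id.atTop_div_const hk
  have h5 := ((h2.comp h4).norm).const_mul (Real.sqrt k)
  rw [norm_zero, mul_zero] at h5
  refine h5.congr' ?_
  filter_upwards [Filter.eventually_gt_atTop 0] with x hx
  simp only [Function.comp]
  rw [norm_mul, Complex.norm_real, Real.norm_eq_abs, abs_of_nonneg (Real.sqrt_nonneg _),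
    mul_div_cancel₀ _ hk.ne', ← mul_assoc, ← Real.sqrt_mul hk.le, mul_div_cancel₀ _ hk.ne']
end
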